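/- arXiv:2301.12420 — 2 statements merged into one kernel-verified Lean document; each statement's English description precedes it below -/
import Mathlib

section
/- Let (Ω,F,P) be a non-atomic probability space, G ⊆ F a sub-σ-algebra, α ∈ (0,1), and let u1, u2 ∈ U⁺_icx be twice differentiable and strictly convex with u1'(0) = u2'(0) = 0. (a) If u1' is convex, u2' is concave, and α·u1''(0) ≥ (1−α)·u2''(0), then the conditional generalized quantile ρ_α^G is a conditional convex risk measure. (b) Conversely, if G is generated by a finite measurable partition {A1,…,An} of Ω with P(Ai) > 0 for all i, and ρ_α^G is a conditional convex risk measure, then u1' is convex, u2' is concave, and α·u1''(0) ≥ (1−α)·u2''(0). -/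
open MeasureTheory Set Filter Topology

variable {Ω : Type*}

/-- `Z ∈ L∞(𝒢)`: `Z` is `𝒢`-measurable and bounded. -/
def BddMeas (𝒢 : MeasurableSpace Ω) (Z : Ω → ℝ) : Prop :=
  Measurable[𝒢] Z ∧ ∃ C : ℝ, ∀ ω, |Z ω| ≤ C

/-- `u ∈ U⁺_icx`: `u` is strictly increasing and convex on `[0,∞)` with `u 0 = 0`, `u 1 = 1`. -/
def Uicx (u : ℝ → ℝ) : Prop :=
  StrictMonoOn u (Set.Ici 0) ∧ ConvexOn ℝ (Set.Ici 0) u ∧ u 0 = 0 ∧ u 1 = 1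

/-- `π_α(X,Z) = α·E[u1((X−Z)⁺)] + (1−α)·E[u2((X−Z)⁻)]`. -/
noncomputable def piRisk {mΩ : MeasurableSpace Ω} (P : Measure Ω) (u1 u2 : ℝ → ℝ) (α : ℝ)
    (X Z : Ω → ℝ) : ℝ :=
  α * ∫ ω, u1 (max (X ω - Z ω) 0) ∂P + (1 - α) * ∫ ω, u2 (max (Z ω - X ω) 0) ∂P

/-- The set of minimizers of `Z ↦ π_α(X,Z)` over `L∞(𝒢)`. -/
def ArgminSet {mΩ : MeasurableSpace Ω} (P : Measure Ω) (𝒢 : MeasurableSpace Ω)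
    (u1 u2 : ℝ → ℝ) (α : ℝ) (X : Ω → ℝ) : Set (Ω → ℝ) :=
  {Z | BddMeas 𝒢 Z ∧ ∀ W, BddMeas 𝒢 W → piRisk P u1 u2 α X Z ≤ piRisk P u1 u2 α X W}

/-- `ρ` is an essential infimum of the family `S` of random variables in the a.s. order. -/
def IsEssInf {mΩ : MeasurableSpace Ω} (P : Measure Ω) (S : Set (Ω → ℝ)) (ρ : Ω → ℝ) : Prop :=
  (∀ Z ∈ S, ρ ≤ᵐ[P] Z) ∧ ∀ W : Ω → ℝ, (∀ Z ∈ S, W ≤ᵐ[P] Z) → W ≤ᵐ[P] ρ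

/-- The probability space is non-atomic. -/
def Nonatomic {mΩ : MeasurableSpace Ω} (P : Measure Ω) : Prop :=
  ∀ A : Set Ω, MeasurableSet[mΩ] A → 0 < P A →
    ∃ B ⊆ A, MeasurableSet[mΩ] B ∧ 0 < P B ∧ P B < P A

/-- The acceptance set of the conditional shortfall risk measure:
`{Z ∈ L∞(𝒢) : E[v(X−Z)|𝒢] ≤ 0 a.s.}`. -/
def ShortfallSet {mΩ : MeasurableSpace Ω} (P : Measure Ω) (𝒢 : MeasurableSpace Ω)
    (v : ℝ → ℝ) (X : Ω → ℝ) : Set (Ω → ℝ) :=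
  {Z | BddMeas 𝒢 Z ∧ ∀ᵐ ω ∂P, (P[fun ω' => v (X ω' - Z ω')|𝒢]) ω ≤ 0}

/-- Left derivative of `u` at `x`, multiplied by the indicator of `{x > 0}`. -/
noncomputable def ldInd (u : ℝ → ℝ) (x : ℝ) : ℝ :=
  if 0 < x then derivWithin u (Set.Iic x) x else 0

/-- Right derivative of `u` at `x`, multiplied by the indicator of `{x ≥ 0}`. -/
noncomputable def rdInd (u : ℝ → ℝ) (x : ℝ) : ℝ :=
  if 0 ≤ x then derivWithin u (Set.Ici x) x else 0

/-- The function `v` built from `u1, u2, α`: `v(x) = α·(u1)'_−(x)` for `x > 0` and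
`v(x) = −(1−α)·(u2)'_+(−x)` for `x ≤ 0`. -/
noncomputable def vFun (u1 u2 : ℝ → ℝ) (α : ℝ) (x : ℝ) : ℝ :=
  if 0 < x then α * derivWithin u1 (Set.Iic x) x
  else -((1 - α) * derivWithin u2 (Set.Ici (-x)) (-x))

/-- `ρ` is a conditional convex risk measure: monotone, conditionally translation
invariant, conditionally convex and normalized. -/
def IsCondConvexRM {mΩ : MeasurableSpace Ω} (P : Measure Ω) (𝒢 : MeasurableSpace Ω)
    (ρ : (Ω → ℝ) → (Ω → ℝ)) : Prop :=
  (∀ X Y : Ω → ℝ, BddMeas mΩ X → BddMeas mΩ Y → X ≤ᵐ[P] Y → ρ X ≤ᵐ[P] ρ Y) ∧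
  (∀ X Z : Ω → ℝ, BddMeas mΩ X → BddMeas 𝒢 Z →
      ρ (fun ω => X ω + Z ω) =ᵐ[P] fun ω => ρ X ω + Z ω) ∧
  (∀ X Y Λ : Ω → ℝ, BddMeas mΩ X → BddMeas mΩ Y → BddMeas 𝒢 Λ →
      (∀ᵐ ω ∂P, 0 ≤ Λ ω ∧ Λ ω ≤ 1) →
      ρ (fun ω => Λ ω * X ω + (1 - Λ ω) * Y ω) ≤ᵐ[P]
        fun ω => Λ ω * ρ X ω + (1 - Λ ω) * ρ Y ω) ∧
  (ρ (fun _ => 0) =ᵐ[P] fun _ => 0)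

/-- `ρ` is a conditional coherent risk measure: a conditional convex risk measure that is
conditionally positively homogeneous. -/
def IsCondCoherentRM {mΩ : MeasurableSpace Ω} (P : Measure Ω) (𝒢 : MeasurableSpace Ω)
    (ρ : (Ω → ℝ) → (Ω → ℝ)) : Prop :=
  IsCondConvexRM P 𝒢 ρ ∧
  ∀ X Λ : Ω → ℝ, BddMeas mΩ X → BddMeas 𝒢 Λ → (∀ᵐ ω ∂P, 0 ≤ Λ ω) →
    ρ (fun ω => Λ ω * X ω) =ᵐ[P] fun ω => Λ ω * ρ X ω

/-- `𝒢` is generated by a finite measurable partition of `Ω`, each cell having positive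
probability. -/
def FinitePartitionGen {mΩ : MeasurableSpace Ω} (P : Measure Ω)
    (𝒢 : MeasurableSpace Ω) : Prop :=
  ∃ (n : ℕ) (A : Fin n → Set Ω),
    (∀ i, MeasurableSet[mΩ] (A i)) ∧ (∀ i, 0 < P (A i)) ∧
    Pairwise (Function.onFun Disjoint A) ∧ (⋃ i, A i) = Set.univ ∧
    𝒢 = MeasurableSpace.generateFrom {s | ∃ i, s = A i}

structure GoodPair (φ v : ℝ → ℝ) : Prop where
  contφ : Continuous φ
  contv : Continuous v
  smono : StrictMono v
  v0 : v 0 = 0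
  tan : ∀ x y, φ x + v x * (y - x) ≤ φ y

noncomputable def phiF (u1 u2 : ℝ → ℝ) (α : ℝ) (x : ℝ) : ℝ :=
  α * u1 (max x 0) + (1 - α) * u2 (max (-x) 0)

noncomputable def vF (du1 du2 : ℝ → ℝ) (α : ℝ) (x : ℝ) : ℝ :=
  α * du1 (max x 0) - (1 - α) * du2 (max (-x) 0)

lemma cont_comp_max {f f' : ℝ → ℝ}
    (h : ∀ x ∈ Set.Ici (0:ℝ), HasDerivWithinAt f (f' x) (Set.Ici 0) x) :
    Continuous fun x : ℝ => f (max x 0) := by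
  have : ContinuousOn f (Set.Ici 0) := fun x hx => (h x hx).continuousWithinAt
  exact this.comp_continuous (by fun_prop) (fun x => by simp)

lemma tangent_ineq {u du : ℝ → ℝ} (hs : ConvexOn ℝ (Set.Ici 0) u)
    (hd : ∀ x ∈ Set.Ici (0:ℝ), HasDerivWithinAt u (du x) (Set.Ici 0) x)
    {x y : ℝ} (hx : 0 ≤ x) (hy : 0 ≤ y) : u x + du x * (y - x) ≤ u y := by
  rcases lt_trichotomy x y with h | h | h
  · have := hs.le_slope_of_hasDerivWithinAt (x := x) (y := y) hx hy h (hd x hx)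
    rw [slope_def_field, le_div_iff₀ (by linarith)] at this
    linarith
  · subst h; simp
  · have := hs.slope_le_of_hasDerivWithinAt (x := y) (y := x) hy hx h (hd x hx)
    rw [slope_def_field, div_le_iff₀ (by linarith)] at this
    linarith

lemma deriv_smono {u du : ℝ → ℝ} (hs : StrictConvexOn ℝ (Set.Ici 0) u)
    (hd : ∀ x ∈ Set.Ici (0:ℝ), HasDerivWithinAt u (du x) (Set.Ici 0) x) :
    StrictMonoOn du (Set.Ici 0) := fun x hx y hy h =>
  (hs.lt_slope_of_hasDerivWithinAt hx hy h (hd x hx)).trans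
    (hs.slope_lt_of_hasDerivWithinAt hx hy h (hd y hy))

lemma goodPair {u1 u2 du1 du2 ddu1 ddu2 : ℝ → ℝ} (h1 : Uicx u1) (h2 : Uicx u2)
    (hs1 : StrictConvexOn ℝ (Set.Ici 0) u1) (hs2 : StrictConvexOn ℝ (Set.Ici 0) u2)
    (hd1 : ∀ x ∈ Set.Ici (0:ℝ), HasDerivWithinAt u1 (du1 x) (Set.Ici 0) x)
    (hd2 : ∀ x ∈ Set.Ici (0:ℝ), HasDerivWithinAt u2 (du2 x) (Set.Ici 0) x)
    (hdd1 : ∀ x ∈ Set.Ici (0:ℝ), HasDerivWithinAt du1 (ddu1 x) (Set.Ici 0) x)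
    (hdd2 : ∀ x ∈ Set.Ici (0:ℝ), HasDerivWithinAt du2 (ddu2 x) (Set.Ici 0) x)
    (hd10 : du1 0 = 0) (hd20 : du2 0 = 0)
    {α : ℝ} (hα : α ∈ Set.Ioo (0:ℝ) 1) :
    GoodPair (phiF u1 u2 α) (vF du1 du2 α) := by
  obtain ⟨ha, hb⟩ := hα
  have hb' : 0 < 1 - α := by linarith
  have m1 := deriv_smono hs1 hd1
  have m2 := deriv_smono hs2 hd2
  have n1 : ∀ x, 0 ≤ x → 0 ≤ u1 x := fun x hx => by
    have := h1.1.monotoneOn (a := 0) (b := x) (by simp) hx hx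
    rwa [h1.2.2.1] at this
  have n2 : ∀ x, 0 ≤ x → 0 ≤ u2 x := fun x hx => by
    have := h2.1.monotoneOn (a := 0) (b := x) (by simp) hx hx
    rwa [h2.2.2.1] at this
  have d1 : ∀ x, 0 ≤ x → 0 ≤ du1 x := fun x hx => by
    have := m1.monotoneOn (a := 0) (b := x) (by simp) hx hx
    rwa [hd10] at this
  have d2 : ∀ x, 0 ≤ x → 0 ≤ du2 x := fun x hx => by
    have := m2.monotoneOn (a := 0) (b := x) (by simp) hx hx
    rwa [hd20] at this
  have z1 := h1.2.2.1
  have z2 := h2.2.2.1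
  refine ⟨?_, ?_, ?_, by simp [vF, hd10, hd20], ?_⟩
  · exact ((cont_comp_max hd1).const_mul α).add
      (((cont_comp_max hd2).comp continuous_neg).const_mul (1 - α))
  · exact ((cont_comp_max hdd1).const_mul α).sub
      (((cont_comp_max hdd2).comp continuous_neg).const_mul (1 - α))
  · intro x y hxy
    unfold vF
    have w1 : du1 (max x 0) ≤ du1 (max y 0) :=
      m1.monotoneOn (by simp) (by simp) (max_le_max hxy.le le_rfl)
    have w2 : du2 (max (-y) 0) ≤ du2 (max (-x) 0) :=
      m2.monotoneOn (by simp) (by simp) (max_le_max (by linarith) le_rfl)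
    rcases lt_or_ge 0 y with hy | hy
    · have : du1 (max x 0) < du1 (max y 0) :=
        m1 (by simp) (by simp) (by simp [hy, hxy])
      nlinarith
    · have : du2 (max (-y) 0) < du2 (max (-x) 0) :=
        m2 (by simp) (by simp) (by
          rw [max_eq_left (by linarith), max_eq_left (by linarith)]; linarith)
      nlinarith
  · intro x y
    unfold vF phiF
    rcases le_total 0 x with hx | hx <;> rcases le_total 0 y with hy | hy
    · rw [max_eq_left hx, max_eq_left hy, max_eq_right (by linarith), max_eq_right (by linarith),
        hd20, z2]
      have := tangent_ineq hs1.convexOn hd1 hx hy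
      nlinarith
    · rw [max_eq_left hx, max_eq_right hy, max_eq_right (by linarith), max_eq_left (by linarith),
        hd20, z1, z2]
      have := tangent_ineq hs1.convexOn hd1 hx le_rfl
      rw [z1] at this
      have t1 := mul_nonneg hb'.le (n2 (-y) (by linarith))
      have t2 := mul_nonneg (d1 x hx) (by linarith : 0 ≤ -y)
      nlinarith
    · rw [max_eq_right hx, max_eq_left hy, max_eq_left (by linarith), max_eq_right (by linarith),
        hd10, z1, z2]
      have := tangent_ineq hs2.convexOn hd2 (x := -x) (by linarith) le_rfl
      rw [z2] at this
      have t1 := mul_nonneg ha.le (n1 y hy)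
      have t2 := mul_nonneg (d2 (-x) (by linarith)) hy
      nlinarith
    · rw [max_eq_right hx, max_eq_right hy, max_eq_left (by linarith), max_eq_left (by linarith),
        hd10, z1]
      have := tangent_ineq hs2.convexOn hd2 (x := -x) (y := -y) (by linarith) (by linarith)
      nlinarith

lemma convex_glue {v f g : ℝ → ℝ} {c : ℝ} 
    (hv : ∀ x, 0 ≤ x → v x = f x) (hv' : ∀ x, x ≤ 0 → v x = g x)
    (hf : ConvexOn ℝ (Set.Ici 0) f) (hg : ConvexOn ℝ (Set.Iic 0) g) (h0 : v 0 = 0)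
    (hfc : ∀ x, 0 ≤ x → c * x ≤ f x) (hgc : ∀ x, x ≤ 0 → c * x ≤ g x) :
    ConvexOn ℝ Set.univ v := by
  have hf0 : f 0 = 0 := by rw [← hv 0 le_rfl, h0]
  have hg0 : g 0 = 0 := by rw [← hv' 0 le_rfl, h0]
  refine LinearOrder.convexOn_of_lt convex_univ ?_
  intro x _ y _ hxy s t hs ht hst
  simp only [smul_eq_mul]
  rcases le_total 0 x with hx | hx
  · rw [hv _ hx, hv y (by linarith), hv _ (by nlinarith)]
    exact hf.2 hx (show 0 ≤ y by linarith) hs.le ht.le hst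
  rcases le_total y 0 with hy | hy
  · rw [hv' _ hx, hv' y (by linarith), hv' _ (by nlinarith)]
    exact hg.2 hx hy hs.le ht.le hst
  rw [hv' x hx, hv y hy]
  have cx := hgc x hx
  have cy := hfc y hy
  rcases le_total 0 (s * x + t * y) with hm | hm
  · rw [hv _ hm]
    have hy0 : 0 < y := by
      rcases hy.lt_or_eq with h | h
      · exact h
      · subst h; nlinarith
    have hl : (s * x + t * y) / y ≤ 1 := by rw [div_le_one hy0]; nlinarith
    have := hf.2 (show (0:ℝ) ∈ Set.Ici 0 by simp) (show y ∈ Set.Ici 0 from hy)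
      (show 0 ≤ 1 - (s * x + t * y) / y by linarith)
      (show 0 ≤ (s * x + t * y) / y by positivity) (by ring)
    simp only [smul_eq_mul, mul_zero, zero_add, hf0] at this
    rw [div_mul_cancel₀ _ hy0.ne'] at this
    refine this.trans ?_
    have e : (s * x + t * y) / y * f y = s * (x * (f y / y)) + t * f y := by field_simp
    rw [e]
    have : c ≤ f y / y := by rw [le_div_iff₀ hy0]; exact cy
    have : x * (f y / y) ≤ x * c := mul_le_mul_of_nonpos_left this hx
    nlinarith
  · rw [hv' _ hm]
    have hx0 : x < 0 := by
      rcases hx.lt_or_eq with h | h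
      · exact h
      · subst h; nlinarith
    have hl : (s * x + t * y) / x ≤ 1 := by rw [div_le_one_of_neg hx0]; nlinarith
    have := hg.2 (show (0:ℝ) ∈ Set.Iic 0 by simp) (show x ∈ Set.Iic 0 from hx)
      (show 0 ≤ 1 - (s * x + t * y) / x by linarith)
      (show 0 ≤ (s * x + t * y) / x from div_nonneg_of_nonpos hm hx) (by ring)
    simp only [smul_eq_mul, mul_zero, zero_add, hg0] at this
    rw [div_mul_cancel₀ _ hx0.ne] at this
    refine this.trans ?_
    have e : (s * x + t * y) / x * g x = s * g x + t * (y * (g x / x)) := by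
      have := hx0.ne
      field_simp
    rw [e]
    have : g x / x ≤ c := by rw [div_le_iff_of_neg hx0]; exact cx
    have : y * (g x / x) ≤ y * c := mul_le_mul_of_nonneg_left this hy
    nlinarith

lemma concave_neg_comp {f : ℝ → ℝ} (hf : ConcaveOn ℝ (Set.Ici 0) f) :
    ConvexOn ℝ (Set.Iic 0) fun x => -f (-x) := by
  refine ⟨convex_Iic 0, fun x hx y hy s t hs ht hst => ?_⟩
  have := hf.2 (x := -x) (y := -y) (by simpa using hx) (by simpa using hy) hs ht hst
  simp only [smul_eq_mul] at this ⊢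
  rw [show -(s * x + t * y) = s * -x + t * -y by ring]
  linarith

lemma vF_convex {du1 du2 ddu1 ddu2 : ℝ → ℝ}
    (hdd1 : ∀ x ∈ Set.Ici (0:ℝ), HasDerivWithinAt du1 (ddu1 x) (Set.Ici 0) x)
    (hdd2 : ∀ x ∈ Set.Ici (0:ℝ), HasDerivWithinAt du2 (ddu2 x) (Set.Ici 0) x)
    (hd10 : du1 0 = 0) (hd20 : du2 0 = 0)
    {α : ℝ} (hα : α ∈ Set.Ioo (0:ℝ) 1)
    (c1 : ConvexOn ℝ (Set.Ici 0) du1) (c2 : ConcaveOn ℝ (Set.Ici 0) du2)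
    (h : (1 - α) * ddu2 0 ≤ α * ddu1 0) : ConvexOn ℝ Set.univ (vF du1 du2 α) := by
  obtain ⟨ha, hb⟩ := hα
  have hb' : 0 < 1 - α := by linarith
  have cc := (concave_neg_comp c2).smul hb'.le
  refine convex_glue (f := fun x => α * du1 x) (g := fun x => (1 - α) * -du2 (-x))
    (c := α * ddu1 0) ?_ ?_ (c1.smul ha.le) cc (by simp [vF, hd10, hd20]) ?_ ?_
  · intro x hx
    simp [vF, hx, hd20]
  · intro x hx
    simp [vF, hx, hd10]
  · intro x hx
    have := tangent_ineq c1 hdd1 le_rfl hx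
    rw [hd10] at this
    nlinarith
  · intro x hx
    have := tangent_ineq (u := -du2) (du := -ddu2) c2.neg
      (fun y hy => (hdd2 y hy).neg) le_rfl (show 0 ≤ -x by linarith)
    simp [hd20] at this
    have h2 : (1 - α) * (ddu2 0 * x) ≤ (1 - α) * -du2 (-x) :=
      mul_le_mul_of_nonneg_left (by linarith) hb'.le
    nlinarith

lemma vF_convex_conv {du1 du2 ddu1 ddu2 : ℝ → ℝ}
    (hdd1 : ∀ x ∈ Set.Ici (0:ℝ), HasDerivWithinAt du1 (ddu1 x) (Set.Ici 0) x)
    (hdd2 : ∀ x ∈ Set.Ici (0:ℝ), HasDerivWithinAt du2 (ddu2 x) (Set.Ici 0) x)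
    (hd10 : du1 0 = 0) (hd20 : du2 0 = 0)
    {α : ℝ} (hα : α ∈ Set.Ioo (0:ℝ) 1)
    (c : ConvexOn ℝ Set.univ (vF du1 du2 α)) :
    ConvexOn ℝ (Set.Ici 0) du1 ∧ ConcaveOn ℝ (Set.Ici 0) du2 ∧ (1 - α) * ddu2 0 ≤ α * ddu1 0 := by
  obtain ⟨ha, hb⟩ := hα
  have hb' : 0 < 1 - α := by linarith
  have e1 : ∀ x, 0 ≤ x → vF du1 du2 α x = α * du1 x := fun x hx => by
    simp [vF, hx, hd20]
  have e2 : ∀ x, 0 ≤ x → vF du1 du2 α (-x) = -((1 - α) * du2 x) := fun x hx => by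
    simp [vF, hx, hd10]
  refine ⟨⟨convex_Ici 0, ?_⟩, ⟨convex_Ici 0, ?_⟩, ?_⟩
  · intro x hx y hy s t hs ht hst
    have := c.2 (mem_univ x) (mem_univ y) hs ht hst
    simp only [smul_eq_mul, Set.mem_Ici] at *
    rw [e1 x hx, e1 y hy, e1 _ (by positivity)] at this
    nlinarith
  · intro x hx y hy s t hs ht hst
    have := c.2 (mem_univ (-x)) (mem_univ (-y)) hs ht hst
    simp only [smul_eq_mul, Set.mem_Ici] at *
    rw [show s * -x + t * -y = -(s * x + t * y) by ring,
      e2 x hx, e2 y hy, e2 _ (by positivity)] at this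
    nlinarith
  · -- for all t>0, (1-α) du2 t ≤ α du1 t
    have key : ∀ t : ℝ, 0 < t → (1 - α) * slope du2 0 t ≤ α * slope du1 0 t := by
      intro t ht
      have := c.2 (mem_univ (-t)) (mem_univ t) (show (0:ℝ) ≤ 1/2 by norm_num)
        (show (0:ℝ) ≤ 1/2 by norm_num) (by norm_num)
      simp only [smul_eq_mul] at this
      rw [show (1/2 : ℝ) * -t + 1/2 * t = 0 by ring, e1 t ht.le, e2 t ht.le, e1 0 le_rfl, hd10]
        at this
      simp only [slope_def_field, hd10, hd20, sub_zero]
      rw [← mul_div_assoc, ← mul_div_assoc]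
      gcongr ?_ / _
      linarith
    have l1 := (hasDerivWithinAt_iff_tendsto_slope' self_notMem_Ioi).mp
      ((hdd1 0 (by simp)).mono Ioi_subset_Ici_self)
    have l2 := (hasDerivWithinAt_iff_tendsto_slope' self_notMem_Ioi).mp
      ((hdd2 0 (by simp)).mono Ioi_subset_Ici_self)
    refine le_of_tendsto_of_tendsto (l2.const_mul (1 - α)) (l1.const_mul α) ?_
    filter_upwards [self_mem_nhdsWithin] with t ht using key t ht

lemma exists_midpoint_of_not_convex {v : ℝ → ℝ} (hv : Continuous v)
    (h : ∀ x y, v ((x + y) / 2) ≤ (v x + v y) / 2) : ConvexOn ℝ Set.univ v := by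
  refine LinearOrder.convexOn_of_lt convex_univ ?_
  intro a _ b _ hab s t hs ht hst
  simp only [smul_eq_mul]
  by_contra! hcon
  set m := (v b - v a) / (b - a) with hm
  have hba : 0 < b - a := by linarith
  set g : ℝ → ℝ := fun x => v x - v a - m * (x - a) with hg
  have gc : Continuous g := by fun_prop
  have ga : g a = 0 := by simp [hg]
  have gb : g b = 0 := by simp [hg, hm]; field_simp; ring
  have gmid : ∀ x y, g ((x + y) / 2) ≤ (g x + g y) / 2 := fun x y => by
    have := h x y
    simp only [hg]
    linarith
  have hz : 0 < g (s * a + t * b) := by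
    have : m * (s * a + t * b - a) = t * (v b - v a) := by
      rw [show s = 1 - t by linarith, show (1 - t) * a + t * b - a = t * (b - a) by ring, hm]
      field_simp
    simp only [hg]
    rw [this]
    have : s = 1 - t := by linarith
    subst this
    linarith
  have hzm : s * a + t * b ∈ Icc a b := by
    have : s = 1 - t := by linarith
    subst this
    constructor <;> nlinarith
  obtain ⟨p, hp, hpm⟩ := isCompact_Icc.exists_isMaxOn ⟨_, hzm⟩ gc.continuousOn
  have hK : IsCompact (Icc a b ∩ g ⁻¹' {g p}) :=
    isCompact_Icc.inter_right (isClosed_singleton.preimage gc)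
  obtain ⟨q, ⟨hq, hqp⟩, hql⟩ := hK.exists_isLeast ⟨p, hp, rfl⟩
  simp only [Set.mem_preimage, Set.mem_singleton_iff] at hqp
  have gp : 0 < g p := hz.trans_le (hpm hzm)
  have hqa : a < q := lt_of_le_of_ne hq.1 (by rintro rfl; linarith)
  have hqb : q < b := lt_of_le_of_ne hq.2 (by rintro rfl; linarith)
  set d := min (q - a) (b - q) with hd
  have hd0 : 0 < d := lt_min (by linarith) (by linarith)
  have hd1 : d ≤ q - a := min_le_left _ _
  have hd2 : d ≤ b - q := min_le_right _ _
  have i1 : q - d ∈ Icc a b := by constructor <;> linarith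
  have i2 : q + d ∈ Icc a b := by constructor <;> linarith
  have j1 : g (q - d) < g p := lt_of_le_of_ne (hpm i1) (fun e => by
    have := hql ⟨i1, e⟩
    linarith)
  have j2 : g (q + d) ≤ g p := hpm i2
  have := gmid (q - d) (q + d)
  rw [show (q - d + (q + d)) / 2 = q by ring] at this
  linarith

lemma small_sets {mΩ : MeasurableSpace Ω} (P : Measure Ω) [IsProbabilityMeasure P]
    (hP : Nonatomic P) {A : Set Ω} (hA : MeasurableSet A) (hpos : 0 < P.real A) (n : ℕ) :
    ∃ B ⊆ A, MeasurableSet B ∧ 0 < P.real B ∧ P.real B ≤ (1/2)^n := by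
  induction n with
  | zero => exact ⟨A, subset_rfl, hA, hpos, by simp⟩
  | succ n ih =>
    obtain ⟨B, hBA, hB, hB0, hBn⟩ := ih
    have hB0' : 0 < P B := by
      rw [pos_iff_ne_zero]; intro h; simp [Measure.real, h] at hB0
    obtain ⟨C, hCB, hC, hC0, hCl⟩ := hP B hB hB0'
    have r0 : 0 < P.real C := ENNReal.toReal_pos hC0.ne' (measure_ne_top _ _)
    have r1 : P.real C < P.real B := (ENNReal.toReal_lt_toReal (measure_ne_top _ _)
      (measure_ne_top _ _)).2 hCl
    have r2 : P.real (B \ C) = P.real B - P.real C := measureReal_sdiff hCB hC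
    rw [pow_succ]
    rcases le_total (P.real C) (P.real B / 2) with h | h
    · exact ⟨C, hCB.trans hBA, hC, r0, by linarith⟩
    · exact ⟨B \ C, sdiff_subset.trans hBA, hB.diff hC, by linarith, by linarith⟩

lemma exists_set_measure_eq {mΩ : MeasurableSpace Ω} (P : Measure Ω) [IsProbabilityMeasure P]
    (hP : Nonatomic P) {A : Set Ω} (hA : MeasurableSet A) {t : ℝ} (ht : 0 ≤ t)
    (htA : t ≤ P.real A) : ∃ B ⊆ A, MeasurableSet B ∧ P.real B = t := by
  let F : Set Ω → Prop := fun B => B ⊆ A ∧ MeasurableSet B ∧ P.real B ≤ t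
  have step : ∀ (n : ℕ) (B : {B // F B}), ∃ B' : {B // F B}, B.1 ⊆ B'.1 ∧
      ∀ D, F D → B.1 ⊆ D → P.real D ≤ P.real B'.1 + 1 / ((n : ℝ) + 1) := by
    intro n B
    let S : Set ℝ := {r | ∃ D, F D ∧ B.1 ⊆ D ∧ P.real D = r}
    have hSb : BddAbove S := ⟨1, by rintro r ⟨D, -, -, rfl⟩; exact measureReal_le_one⟩
    have hSn : S.Nonempty := ⟨_, B.1, B.2, subset_rfl, rfl⟩
    have hpos : (0:ℝ) < 1 / ((n : ℝ) + 1) := by positivity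
    obtain ⟨r, ⟨D, hD, hBD, rfl⟩, hr⟩ := exists_lt_of_lt_csSup hSn
      (show sSup S - 1 / ((n : ℝ) + 1) < sSup S by linarith)
    refine ⟨⟨D, hD⟩, hBD, fun E hE hBE => ?_⟩
    have := le_csSup hSb ⟨E, hE, hBE, rfl⟩
    simp only
    linarith
  choose g hg1 hg2 using step
  let B : ℕ → {B // F B} := fun n => Nat.rec ⟨∅, by simp [F, ht]⟩ (fun n b => g n b) n
  have hB : ∀ n, B (n + 1) = g n (B n) := fun n => rfl
  have hmono : Monotone fun n => (B n).1 := monotone_nat_of_le_succ fun n => by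
    simp only [hB]; exact hg1 n (B n)
  let U := ⋃ n, (B n).1
  have hUA : U ⊆ A := iUnion_subset fun n => (B n).2.1
  have hUm : MeasurableSet U := MeasurableSet.iUnion fun n => (B n).2.2.1
  have hUt : P.real U ≤ t := by
    have := tendsto_measure_iUnion_atTop (μ := P) hmono
    have h2 : Tendsto (fun n => P.real (B n).1) atTop (𝓝 (P.real U)) :=
      (ENNReal.tendsto_toReal (measure_ne_top _ _)).comp this
    exact le_of_tendsto' h2 fun n => (B n).2.2.2
  refine ⟨U, hUA, hUm, le_antisymm hUt ?_⟩
  by_contra! hlt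
  have hdiff : P.real (A \ U) = P.real A - P.real U := measureReal_sdiff hUA hUm
  obtain ⟨n, hn⟩ := exists_pow_lt_of_lt_one (sub_pos.2 hlt) (show (1/2:ℝ) < 1 by norm_num)
  obtain ⟨C, hCA, hC, hC0, hCn⟩ := small_sets P hP (hA.diff hUm) (by linarith) n
  have hdis : Disjoint U C := (disjoint_sdiff_right).mono_right hCA
  have hUC : P.real (U ∪ C) = P.real U + P.real C := measureReal_union hdis hC
  have hF : F (U ∪ C) := ⟨union_subset hUA (hCA.trans sdiff_subset), hUm.union hC, by linarith⟩
  have hle : ∀ n : ℕ, P.real C ≤ 1 / ((n : ℝ) + 1) := fun n => by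
    have h1 := hg2 n (B n) (U ∪ C) hF ((subset_iUnion (fun n => (B n).1) n).trans subset_union_left)
    rw [← hB] at h1
    have h2 : P.real (B (n+1)).1 ≤ P.real U :=
      measureReal_mono (subset_iUnion (fun n => (B n).1) (n+1))
    linarith
  obtain ⟨n, hn⟩ := exists_nat_one_div_lt hC0
  linarith [hle n]
 

namespace BddMeas

variable {m m' : MeasurableSpace Ω} {X Y : Ω → ℝ}

lemma mono (h : m ≤ m') (hX : BddMeas m X) : BddMeas m' X := ⟨hX.1.mono h le_rfl, hX.2⟩

lemma const (c : ℝ) : BddMeas m fun _ => c := ⟨measurable_const, |c|, fun _ => le_rfl⟩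

lemma add (hX : BddMeas m X) (hY : BddMeas m Y) : BddMeas m fun ω => X ω + Y ω := by
  obtain ⟨a, C, hC⟩ := hX
  obtain ⟨b, D, hD⟩ := hY
  exact ⟨a.add b, C + D, fun ω => (abs_add_le _ _).trans (add_le_add (hC ω) (hD ω))⟩

lemma mul (hX : BddMeas m X) (hY : BddMeas m Y) : BddMeas m fun ω => X ω * Y ω := by
  obtain ⟨a, C, hC⟩ := hX
  obtain ⟨b, D, hD⟩ := hY
  refine ⟨a.mul b, C * D, fun ω => ?_⟩
  rw [abs_mul]
  exact mul_le_mul (hC ω) (hD ω) (abs_nonneg _) ((abs_nonneg _).trans (hC ω))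

lemma neg (hX : BddMeas m X) : BddMeas m fun ω => -X ω := by
  simpa using (const (-1)).mul hX

lemma sub (hX : BddMeas m X) (hY : BddMeas m Y) : BddMeas m fun ω => X ω - Y ω := by
  simpa [sub_eq_add_neg] using hX.add hY.neg

lemma comp {f : ℝ → ℝ} (hf : Continuous f) (hX : BddMeas m X) : BddMeas m fun ω => f (X ω) := by
  obtain ⟨a, C, hC⟩ := hX
  obtain ⟨D, hD⟩ := (isCompact_Icc (a := -C) (b := C)).exists_bound_of_continuousOn hf.continuousOn
  exact ⟨hf.measurable.comp a, D, fun ω => hD _ (abs_le.1 (hC ω))⟩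

lemma ind {A : Set Ω} (hA : MeasurableSet[m] A) : BddMeas m (A.indicator fun _ => (1:ℝ)) :=
  ⟨measurable_const.indicator hA, 1, fun ω => by
    by_cases h : ω ∈ A <;> simp [h]⟩

lemma integrable {mΩ : MeasurableSpace Ω} {P : Measure Ω} [IsProbabilityMeasure P]
    (hX : BddMeas mΩ X) : Integrable X P := by
  obtain ⟨a, C, hC⟩ := hX
  exact Integrable.of_bound a.aestronglyMeasurable C (ae_of_all _ hC)

end BddMeas

lemma piRisk_eq {mΩ : MeasurableSpace Ω} (P : Measure Ω) [IsProbabilityMeasure P]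
    {u1 u2 : ℝ → ℝ} {α : ℝ} (c1 : Continuous fun x : ℝ => u1 (max x 0))
    (c2 : Continuous fun x : ℝ => u2 (max x 0))
    {X Z : Ω → ℝ} (hX : BddMeas mΩ X) (hZ : BddMeas mΩ Z) :
    piRisk P u1 u2 α X Z = ∫ ω, phiF u1 u2 α (X ω - Z ω) ∂P := by
  have i1 := ((hX.sub hZ).comp c1).integrable (P := P)
  have i2 := ((hZ.sub hX).comp c2).integrable (P := P)
  simp only [piRisk, phiF, neg_sub]
  rw [integral_add (i1.const_mul α) (i2.const_mul (1 - α)), integral_const_mul, integral_const_mul]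

/-- First-order condition. -/
def FOC {mΩ : MeasurableSpace Ω} (P : Measure Ω) (𝒢 : MeasurableSpace Ω) (v : ℝ → ℝ)
    (X Z : Ω → ℝ) : Prop :=
  BddMeas 𝒢 Z ∧ ∀ H, BddMeas 𝒢 H → ∫ ω, v (X ω - Z ω) * H ω ∂P = 0

section
variable {mΩ : MeasurableSpace Ω} {P : Measure Ω} [IsProbabilityMeasure P]
    {𝒢 : MeasurableSpace Ω} {φ v : ℝ → ℝ} 

lemma foc_le (hG : 𝒢 ≤ mΩ) (hg : GoodPair φ v) {X Z : Ω → ℝ} (hX : BddMeas mΩ X)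
    (hZ : BddMeas 𝒢 Z)
    (hmin : ∀ W, BddMeas 𝒢 W → ∫ ω, φ (X ω - Z ω) ∂P ≤ ∫ ω, φ (X ω - W ω) ∂P)
    {H : Ω → ℝ} (hH : BddMeas 𝒢 H) : ∫ ω, v (X ω - Z ω) * H ω ∂P ≤ 0 := by
  have hXZ := hX.sub (hZ.mono hG)
  have hH' := hH.mono hG
  have key : ∀ t : ℝ, 0 < t → ∫ ω, v (X ω - Z ω - t * H ω) * H ω ∂P ≤ 0 := by
    intro t ht
    have h1 := hmin _ (hZ.add ((BddMeas.const t).mul hH))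
    have b1 := (hXZ.comp hg.contφ).integrable (P := P)
    have b2 := ((hXZ.sub ((BddMeas.const t).mul hH')).comp hg.contφ).integrable (P := P)
    have b3 := (((hXZ.sub ((BddMeas.const t).mul hH')).comp hg.contv).mul hH').integrable (P := P)
    have h2 : ∫ ω, (φ (X ω - Z ω - t * H ω) + t * (v (X ω - Z ω - t * H ω) * H ω)) ∂P
        ≤ ∫ ω, φ (X ω - Z ω) ∂P := by
      refine integral_mono (b2.add (b3.const_mul t)) b1 fun ω => ?_
      have := hg.tan (X ω - Z ω - t * H ω) (X ω - Z ω)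
      simp only
      nlinarith
    rw [integral_add b2 (b3.const_mul t), integral_const_mul] at h2
    simp only [← sub_sub] at h1
    by_contra! hc
    nlinarith
  have hlim : Tendsto (fun n : ℕ => ∫ ω, v (X ω - Z ω - 1 / ((n:ℝ) + 1) * H ω) * H ω ∂P) atTop
      (𝓝 (∫ ω, v (X ω - Z ω) * H ω ∂P)) := by
    obtain ⟨C, hC⟩ := hXZ.2
    obtain ⟨D, hD⟩ := hH'.2
    obtain ⟨K, hK⟩ := (isCompact_Icc (a := -(C+D)) (b := C+D)).exists_bound_of_continuousOn
      hg.contv.continuousOn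
    refine tendsto_integral_of_dominated_convergence (fun _ => K * D) ?_ (integrable_const _) ?_ ?_
    · intro n
      exact (((hXZ.sub ((BddMeas.const _).mul hH')).comp hg.contv).mul hH').1.aestronglyMeasurable
    · intro n
      refine ae_of_all _ fun ω => ?_
      rw [norm_mul]
      have hn : |1 / ((n:ℝ) + 1) * H ω| ≤ D := by
        rw [abs_mul, abs_of_nonneg (by positivity : (0:ℝ) ≤ 1 / ((n:ℝ) + 1))]
        have : 1 / ((n:ℝ) + 1) ≤ 1 := by
          rw [div_le_one (by positivity)]; linarith [n.cast_nonneg (α := ℝ)]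
        nlinarith [hD ω, abs_nonneg (H ω)]
      have := hK (X ω - Z ω - 1 / ((n:ℝ) + 1) * H ω) (abs_le.1 ((abs_sub _ _).trans
        (add_le_add (hC ω) hn)))
      exact mul_le_mul this (hD ω) (abs_nonneg _) ((norm_nonneg _).trans this)
    · refine ae_of_all _ fun ω => ?_
      have h0 : Tendsto (fun n : ℕ => X ω - Z ω - 1 / ((n:ℝ) + 1) * H ω) atTop
          (𝓝 (X ω - Z ω - 0 * H ω)) :=
        (tendsto_one_div_add_atTop_nhds_zero_nat.mul_const _).const_sub _
      rw [zero_mul, sub_zero] at h0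
      exact ((hg.contv.tendsto _).comp h0).mul_const _
  exact le_of_tendsto' hlim fun n => key _ (by positivity)

lemma foc_of_min (hG : 𝒢 ≤ mΩ) (hg : GoodPair φ v) {X Z : Ω → ℝ} (hX : BddMeas mΩ X)
    (hZ : BddMeas 𝒢 Z)
    (hmin : ∀ W, BddMeas 𝒢 W → ∫ ω, φ (X ω - Z ω) ∂P ≤ ∫ ω, φ (X ω - W ω) ∂P) :
    FOC P 𝒢 v X Z := by
  refine ⟨hZ, fun H hH => le_antisymm (foc_le hG hg hX hZ hmin hH) ?_⟩
  have := foc_le hG hg hX hZ hmin hH.neg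
  simp only [mul_neg, integral_neg] at this
  linarith

lemma min_of_foc (hG : 𝒢 ≤ mΩ) (hg : GoodPair φ v) {X Z : Ω → ℝ} (hX : BddMeas mΩ X)
    (h : FOC P 𝒢 v X Z) (W : Ω → ℝ) (hW : BddMeas 𝒢 W) :
    ∫ ω, φ (X ω - Z ω) ∂P ≤ ∫ ω, φ (X ω - W ω) ∂P := by
  have hXZ := hX.sub (h.1.mono hG)
  have hXW := hX.sub (hW.mono hG)
  have b1 := (hXZ.comp hg.contφ).integrable (P := P)
  have b2 := (hXW.comp hg.contφ).integrable (P := P)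
  have b3 := ((hXZ.comp hg.contv).mul ((h.1.sub hW).mono hG)).integrable (P := P)
  have h2 : ∫ ω, (φ (X ω - Z ω) + v (X ω - Z ω) * (Z ω - W ω)) ∂P
        ≤ ∫ ω, φ (X ω - W ω) ∂P := by
    refine integral_mono (b1.add b3) b2 fun ω => ?_
    have := hg.tan (X ω - Z ω) (X ω - W ω)
    simp only
    rwa [show X ω - W ω - (X ω - Z ω) = Z ω - W ω by ring] at this
  rw [integral_add b1 b3, h.2 _ (h.1.sub hW)] at h2
  linarith

lemma foc_compare (hG : 𝒢 ≤ mΩ) (hg : GoodPair φ v) {X Z Z' : Ω → ℝ} (hX : BddMeas mΩ X)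
    (h : FOC P 𝒢 v X Z) (hZ' : BddMeas 𝒢 Z')
    (h' : ∀ A, MeasurableSet[𝒢] A → ∫ ω, v (X ω - Z' ω) * A.indicator (fun _ => 1) ω ∂P ≤ 0) :
    Z ≤ᵐ[P] Z' := by
  let A : Set Ω := {ω | Z' ω < Z ω}
  have hA : MeasurableSet[𝒢] A := measurableSet_lt hZ'.1 h.1.1
  have hI := (BddMeas.ind hA)
  have h0 := h.2 _ hI
  have h1 := h' A hA
  have b1 := (((hX.sub (h.1.mono hG)).comp hg.contv).mul (hI.mono hG)).integrable (P := P)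
  have b2 := (((hX.sub (hZ'.mono hG)).comp hg.contv).mul (hI.mono hG)).integrable (P := P)
  have hnn : ∀ ω, 0 ≤ v (X ω - Z' ω) * A.indicator (fun _ => 1) ω -
      v (X ω - Z ω) * A.indicator (fun _ => 1) ω := by
    intro ω
    by_cases hω : ω ∈ A
    · simp only [hω, indicator_of_mem, mul_one, sub_nonneg]
      exact hg.smono.monotone (by have : Z' ω < Z ω := hω; linarith)
    · simp [hω]
  have hz : ∫ ω, (v (X ω - Z' ω) * A.indicator (fun _ => 1) ω -
      v (X ω - Z ω) * A.indicator (fun _ => 1) ω) ∂P = 0 := by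
    refine le_antisymm ?_ (integral_nonneg hnn)
    rw [integral_sub b2 b1, h0]
    linarith
  rw [integral_eq_zero_iff_of_nonneg hnn (b2.sub b1)] at hz
  filter_upwards [hz] with ω hω
  by_contra! hlt
  have hm : ω ∈ A := hlt
  simp only [hm, indicator_of_mem, mul_one, Pi.zero_apply] at hω
  have := hg.smono (show X ω - Z ω < X ω - Z' ω by linarith)
  linarith

lemma foc_unique (hG : 𝒢 ≤ mΩ) (hg : GoodPair φ v) {X Z Z' : Ω → ℝ} (hX : BddMeas mΩ X)
    (h : FOC P 𝒢 v X Z) (h' : FOC P 𝒢 v X Z') : Z ≤ᵐ[P] Z' :=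
  foc_compare hG hg hX h h'.1 fun _ hA => (h'.2 _ (BddMeas.ind hA)).le

end

/-- Abstract characterization of `ρ`. -/
lemma rho_spec {mΩ : MeasurableSpace Ω} (P : Measure Ω) [IsProbabilityMeasure P]
    {𝒢 : MeasurableSpace Ω} (hG : 𝒢 ≤ mΩ) {u1 u2 v : ℝ → ℝ} {α : ℝ}
    (c1 : Continuous fun x : ℝ => u1 (max x 0))
    (c2 : Continuous fun x : ℝ => u2 (max x 0))
    (hg : GoodPair (phiF u1 u2 α) v)
    (ρ : (Ω → ℝ) → (Ω → ℝ))
    (hρ : ∀ X : Ω → ℝ, BddMeas mΩ X → IsEssInf P (ArgminSet P 𝒢 u1 u2 α X) (ρ X))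
    (X : Ω → ℝ) (hX : BddMeas mΩ X) :
    (∃ Z, FOC P 𝒢 v X Z) ∧ ∀ Z, FOC P 𝒢 v X Z → ρ X =ᵐ[P] Z := by
  have hiff : ∀ Z, Z ∈ ArgminSet P 𝒢 u1 u2 α X ↔ FOC P 𝒢 v X Z := by
    intro Z
    constructor
    · rintro ⟨hZ, hm⟩
      refine foc_of_min hG hg hX hZ fun W hW => ?_
      have := hm W hW
      rwa [piRisk_eq P c1 c2 hX (hZ.mono hG), piRisk_eq P c1 c2 hX (hW.mono hG)] at this
    · intro h
      refine ⟨h.1, fun W hW => ?_⟩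
      rw [piRisk_eq P c1 c2 hX (h.1.mono hG), piRisk_eq P c1 c2 hX (hW.mono hG)]
      exact min_of_foc hG hg hX h W hW
  obtain ⟨i1, i2⟩ := hρ X hX
  constructor
  · by_contra! hne
    have := i2 (fun ω => ρ X ω + 1) fun Z hZ => absurd ((hiff Z).1 hZ) (hne Z)
    obtain ⟨ω, hω⟩ := this.exists
    linarith
  · intro Z hZ
    exact (i1 Z ((hiff Z).2 hZ)).antisymm
      (i2 Z fun Z' hZ' => foc_unique hG hg hX hZ ((hiff Z').1 hZ'))
 

lemma atom_of_partition {n : ℕ} {A : Fin n → Set Ω}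
    (hd : Pairwise (Function.onFun Disjoint A)) (i : Fin n) {S : Set Ω}
    (hS : MeasurableSet[MeasurableSpace.generateFrom {s | ∃ i, s = A i}] S) :
    A i ⊆ S ∨ Disjoint (A i) S := by
  induction S, hS using MeasurableSpace.generateFrom_induction with
  | hC t ht _ =>
    obtain ⟨j, rfl⟩ := ht
    by_cases h : i = j
    · subst h; exact Or.inl subset_rfl
    · exact Or.inr (hd h)
  | empty => simp
  | compl t _ ih =>
    rcases ih with h | h
    · right; exact disjoint_compl_right_iff_subset.2 h
    · left; exact h.subset_compl_right
  | iUnion f _ ih =>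
    by_cases h : ∃ k, A i ⊆ f k
    · obtain ⟨k, hk⟩ := h
      exact Or.inl (hk.trans (subset_iUnion f k))
    · push Not at h
      right
      rw [disjoint_iUnion_right]
      exact fun k => (ih k).resolve_left (h k)

section
variable {mΩ : MeasurableSpace Ω} (P : Measure Ω) [IsProbabilityMeasure P]
    {𝒢 : MeasurableSpace Ω} {φ v : ℝ → ℝ} 

lemma partA (hG : 𝒢 ≤ mΩ) (hg : GoodPair φ v) (hc : ConvexOn ℝ Set.univ v)
    (ρ : (Ω → ℝ) → (Ω → ℝ))
    (hρ : ∀ X : Ω → ℝ, BddMeas mΩ X →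
      (∃ Z, FOC P 𝒢 v X Z) ∧ ∀ Z, FOC P 𝒢 v X Z → ρ X =ᵐ[P] Z) :
    IsCondConvexRM P 𝒢 ρ := by
  refine ⟨?_, ?_, ?_, ?_⟩
  · intro X Y hX hY hXY
    obtain ⟨⟨Z, hZ⟩, h1⟩ := hρ X hX
    obtain ⟨⟨W, hW⟩, h2⟩ := hρ Y hY
    have : Z ≤ᵐ[P] W := by
      refine foc_compare hG hg hX hZ hW.1 fun A hA => ?_
      rw [← hW.2 _ (BddMeas.ind hA)]
      have hI := (BddMeas.ind hA).mono hG
      refine integral_mono_ae (((hX.sub (hW.1.mono hG)).comp hg.contv).mul hI).integrable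
        (((hY.sub (hW.1.mono hG)).comp hg.contv).mul hI).integrable ?_
      filter_upwards [hXY] with ω hω
      refine mul_le_mul_of_nonneg_right (hg.smono.monotone (by linarith)) ?_
      exact indicator_nonneg (by simp) _
    filter_upwards [h1 Z hZ, h2 W hW, this] with ω a b c
    rw [a, b]; exact c
  · intro X H hX hH
    obtain ⟨⟨Z, hZ⟩, h1⟩ := hρ X hX
    have h2 := (hρ _ (hX.add (hH.mono hG))).2 (fun ω => Z ω + H ω) ⟨hZ.1.add hH, fun K hK => by
      simpa using hZ.2 K hK⟩
    filter_upwards [h1 Z hZ, h2] with ω a b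
    rw [a, b]
  · intro X Y Λ hX hY hΛ hΛ1
    obtain ⟨⟨Z, hZ⟩, h1⟩ := hρ X hX
    obtain ⟨⟨W, hW⟩, h2⟩ := hρ Y hY
    have hΛ' := (BddMeas.const (m := 𝒢) 1).sub hΛ
    have hM := ((hΛ.mono hG).mul hX).add ((hΛ'.mono hG).mul hY)
    obtain ⟨⟨V, hV⟩, h3⟩ := hρ _ hM
    have hT := (hΛ.mul hZ.1).add (hΛ'.mul hW.1)
    have : V ≤ᵐ[P] fun ω => Λ ω * Z ω + (1 - Λ ω) * W ω := by
      refine foc_compare hG hg hM hV hT fun A hA => ?_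
      have hI := BddMeas.ind hA
      have z1 := hZ.2 _ (hΛ.mul hI)
      have z2 := hW.2 _ (hΛ'.mul hI)
      have b1 := (((hX.sub (hZ.1.mono hG)).comp hg.contv).mul
        ((hΛ.mul hI).mono hG)).integrable (P := P)
      have b2 := (((hY.sub (hW.1.mono hG)).comp hg.contv).mul
        ((hΛ'.mul hI).mono hG)).integrable (P := P)
      rw [← add_zero (0:ℝ)]
      nth_rw 2 [← z1]
      rw [← z2, add_comm, ← integral_add b1 b2]
      refine integral_mono_ae (((hM.sub (hT.mono hG)).comp hg.contv).mul (hI.mono hG)).integrable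
        (b1.add b2) ?_
      filter_upwards [hΛ1] with ω hω
      have hcv := hc.2 (mem_univ (X ω - Z ω)) (mem_univ (Y ω - W ω)) hω.1
        (sub_nonneg.2 hω.2) (by ring)
      simp only [smul_eq_mul] at hcv
      have hi : (0:ℝ) ≤ A.indicator (fun _ => 1) ω := indicator_nonneg (by simp) _
      have := mul_le_mul_of_nonneg_right hcv hi
      rw [show Λ ω * X ω + (1 - Λ ω) * Y ω - (Λ ω * Z ω + (1 - Λ ω) * W ω)
        = Λ ω * (X ω - Z ω) + (1 - Λ ω) * (Y ω - W ω) by ring]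
      linarith
    filter_upwards [h1 Z hZ, h2 W hW, h3 V hV, this] with ω a b c d
    rw [a, b, c]; exact d
  · exact (hρ _ (BddMeas.const 0)).2 _ ⟨BddMeas.const 0, fun H _ => by simp [hg.v0]⟩


lemma partB (hP : Nonatomic P) (hG : 𝒢 ≤ mΩ) (hg : GoodPair φ v)
    (ρ : (Ω → ℝ) → (Ω → ℝ))
    (hρ : ∀ X : Ω → ℝ, BddMeas mΩ X →
      (∃ Z, FOC P 𝒢 v X Z) ∧ ∀ Z, FOC P 𝒢 v X Z → ρ X =ᵐ[P] Z)
    (hfin : FinitePartitionGen P 𝒢) (hrm : IsCondConvexRM P 𝒢 ρ) : ConvexOn ℝ Set.univ v := by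
  refine exists_midpoint_of_not_convex hg.contv fun x y => ?_
  by_contra! hxy
  obtain ⟨n, A, hAm, hA0, hAd, hAu, rfl⟩ := hfin
  have hne : Nonempty (Fin n) := by
    by_contra hn
    rw [not_nonempty_iff] at hn
    have : (univ : Set Ω) = ∅ := by rw [← hAu]; simp
    have h1 := measure_univ (μ := P)
    rw [this] at h1
    simp at h1
  obtain ⟨i⟩ := hne
  set a := P.real (A i) with ha
  have ha0 : 0 < a := ENNReal.toReal_pos (hA0 i).ne' (measure_ne_top _ _)
  -- choose q and z
  set c := v x + v y with hc
  obtain ⟨q, z, hq0, hqa, hz⟩ : ∃ q z : ℝ, 0 < q ∧ 2 * q ≤ a ∧ q * c + (a - 2 * q) * v z = 0 := by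
    have hv1 : 0 < v 1 := by have := hg.smono (show (0:ℝ) < 1 by norm_num); rwa [hg.v0] at this
    have hv2 : v (-1) < 0 := by have := hg.smono (show (-1:ℝ) < 0 by norm_num); rwa [hg.v0] at this
    have hlim : Tendsto (fun q : ℝ => -(q * c) / (a - 2 * q)) (𝓝[>] 0) (𝓝 0) := by
      have : ContinuousAt (fun q : ℝ => -(q * c) / (a - 2 * q)) 0 := by
        refine ContinuousAt.div (by fun_prop) (by fun_prop) (by simpa using ha0.ne')
      have := this.tendsto
      simp only [zero_mul, neg_zero, zero_div] at this
      exact this.mono_left nhdsWithin_le_nhds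
    have e1 := hlim.eventually (Ioo_mem_nhds hv2 hv1)
    have e2 : ∀ᶠ q : ℝ in 𝓝[>] 0, q < a / 2 :=
      nhdsWithin_le_nhds (eventually_lt_nhds (by linarith))
    obtain ⟨q, hq1, hq2, hq3⟩ := (e1.and (e2.and self_mem_nhdsWithin)).exists
    obtain ⟨z, -, hz⟩ := intermediate_value_Icc (show (-1:ℝ) ≤ 1 by norm_num)
      hg.contv.continuousOn (Ioo_subset_Icc_self hq1)
    refine ⟨q, z, hq3, by linarith, ?_⟩
    rw [hz]
    have : a - 2 * q ≠ 0 := by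
      have : 0 < a - 2 * q := by linarith
      exact this.ne'
    rw [mul_div_cancel₀ _ this]
    ring
  obtain ⟨B1, hB1A, hB1, hq1⟩ := exists_set_measure_eq P hP (hAm i) hq0.le (by linarith)
  have hdiff : P.real (A i \ B1) = a - q := by rw [measureReal_sdiff hB1A hB1, hq1]
  obtain ⟨B2, hB2A, hB2, hq2⟩ := exists_set_measure_eq P hP ((hAm i).diff hB1) (t := q) hq0.le
    (by linarith)
  set C := (A i \ B1) \ B2 with hCd
  have hC : MeasurableSet C := ((hAm i).diff hB1).diff hB2
  have hPC : P.real C = a - 2 * q := by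
    rw [hCd, measureReal_sdiff hB2A hB2, hdiff, hq2]; ring
  -- three-valued random variables
  let T : ℝ → ℝ → ℝ → Ω → ℝ := fun r s t ω => r * B1.indicator (fun _ => 1) ω +
    s * B2.indicator (fun _ => 1) ω + t * C.indicator (fun _ => 1) ω
  have hT : ∀ r s t, BddMeas mΩ (T r s t) := fun r s t =>
    (((BddMeas.const r).mul (BddMeas.ind hB1)).add ((BddMeas.const s).mul (BddMeas.ind hB2))).add
      ((BddMeas.const t).mul (BddMeas.ind hC))
  have hval : ∀ r s t ω, v (T r s t ω) = T (v r) (v s) (v t) ω := by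
    intro r s t ω
    by_cases m1 : ω ∈ B1
    · have m2 : ω ∉ B2 := fun h => (hB2A h).2 m1
      have m3 : ω ∉ C := fun h => h.1.2 m1
      simp [T, m1, m2, m3]
    · by_cases m2 : ω ∈ B2
      · have m3 : ω ∉ C := fun h => h.2 m2
        simp [T, m1, m2, m3]
      · by_cases m3 : ω ∈ C <;> simp [T, m1, m2, m3, hg.v0]
  have hint : ∀ r s t, ∫ ω, T r s t ω ∂P = r * q + s * q + t * (a - 2 * q) := by
    intro r s t
    have b1 := (BddMeas.ind hB1).integrable (P := P)
    have b2 := (BddMeas.ind hB2).integrable (P := P)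
    have b3 := (BddMeas.ind hC).integrable (P := P)
    simp only [T]
    have b4 : Integrable (fun ω => r * B1.indicator (fun _ => (1:ℝ)) ω +
      s * B2.indicator (fun _ => 1) ω) P := (b1.const_mul r).add (b2.const_mul s)
    rw [integral_add b4 (b3.const_mul t), integral_add (b1.const_mul r) (b2.const_mul s), integral_const_mul, integral_const_mul,
      integral_const_mul, integral_indicator_const _ hB1, integral_indicator_const _ hB2,
      integral_indicator_const _ hC, hq1, hq2, hPC]
    simp
  have hsupp : ∀ r s t ω, ω ∉ A i → T r s t ω = 0 := by
    intro r s t ω hω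
    have m1 : ω ∉ B1 := fun h => hω (hB1A h)
    have m2 : ω ∉ B2 := fun h => hω (hB2A h).1
    have m3 : ω ∉ C := fun h => hω h.1.1
    simp [T, m1, m2, m3]
  -- integrals against 𝒢-measurable functions
  have hGH : ∀ H : Ω → ℝ, BddMeas (MeasurableSpace.generateFrom {s | ∃ i, s = A i}) H →
      ∃ k, ∀ ω ∈ A i, H ω = k := by
    intro H hH
    by_cases hn : (A i).Nonempty
    · obtain ⟨ω0, h0⟩ := hn
      refine ⟨H ω0, fun ω hω => ?_⟩
      have hS : MeasurableSet[MeasurableSpace.generateFrom {s | ∃ i, s = A i}] (H ⁻¹' {H ω0}) :=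
        hH.1 (measurableSet_singleton _)
      rcases atom_of_partition hAd i hS with h | h
      · exact h hω
      · exact absurd rfl (disjoint_left.1 h h0)
    · exact ⟨0, fun ω hω => absurd ⟨ω, hω⟩ hn⟩
  have hfoc : ∀ r s, v r + v s = c → ρ (T r s z) =ᵐ[P] fun _ => 0 := by
    intro r s hrs
    refine (hρ _ (hT r s z)).2 _ ⟨BddMeas.const 0, fun H hH => ?_⟩
    obtain ⟨k, hk⟩ := hGH H hH
    have : ∀ ω, v (T r s z ω - 0) * H ω = T (v r) (v s) (v z) ω * k := by
      intro ω
      rw [sub_zero, hval]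
      by_cases hω : ω ∈ A i
      · rw [hk ω hω]
      · rw [hsupp _ _ _ _ hω]; simp
    simp only [this]
    rw [integral_mul_const, hint]
    have : v r * q + v s * q + v z * (a - 2 * q) = 0 := by rw [← hz, ← hrs]; ring
    rw [this, zero_mul]
  have hX := hfoc x y rfl
  have hY := hfoc y x (add_comm _ _)
  have hconv := hrm.2.2.1 (T x y z) (T y x z) (fun _ => 1/2) (hT _ _ _) (hT _ _ _)
    (BddMeas.const _) (ae_of_all _ fun _ => by norm_num)
  have hMe : (fun ω => (1/2 : ℝ) * T x y z ω + (1 - 1/2) * T y x z ω)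
      = T ((x + y) / 2) ((x + y) / 2) z := by
    funext ω
    simp only [T]
    ring
  rw [hMe] at hconv
  obtain ⟨⟨V, hV⟩, hV2⟩ := hρ _ (hT ((x + y) / 2) ((x + y) / 2) z)
  have hAG : MeasurableSet[MeasurableSpace.generateFrom {s | ∃ i, s = A i}] (A i) :=
    MeasurableSpace.measurableSet_generateFrom ⟨i, rfl⟩
  have h0 := hV.2 _ (BddMeas.ind hAG)
  have hlow : ∫ ω, T (v ((x + y) / 2)) (v ((x + y) / 2)) (v z) ω ∂P ≤ 0 := by
    rw [← h0]
    refine integral_mono_ae (hT _ _ _).integrable ((((hT _ _ _).sub (hV.1.mono hG)).comp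
      hg.contv).mul ((BddMeas.ind hAG).mono hG)).integrable ?_
    filter_upwards [hX, hY, hconv, hV2 V hV] with ω e1 e2 e3 e4
    rw [e1, e2, e4] at e3
    rw [← hval]
    by_cases hω : ω ∈ A i
    · simp only [hω, indicator_of_mem, mul_one]
      exact hg.smono.monotone (by linarith)
    · simp [hω, hsupp _ _ _ _ hω, hg.v0]
  rw [hint] at hlow
  nlinarith
end

/-- Theorem 5.1 (i): for twice differentiable strictly convex
`u1, u2 ∈ U⁺_icx` with `u1'(0) = u2'(0) = 0`:
(a) if `u1'` is convex, `u2'` is concave and `α·u1''(0) ≥ (1−α)·u2''(0)`, then the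
conditional generalized quantile is a conditional convex risk measure;
(b) conversely, if `𝒢` is generated by a finite partition of `Ω` with cells of positive
probability and the conditional generalized quantile is a conditional convex risk measure,
then `u1'` is convex, `u2'` is concave and `α·u1''(0) ≥ (1−α)·u2''(0)`. -/
theorem conditional_generalized_quantile_convex_characterization
    [mΩ : MeasurableSpace Ω] (P : Measure Ω) [IsProbabilityMeasure P]
    (hP : Nonatomic P) (𝒢 : MeasurableSpace Ω) (hG : 𝒢 ≤ mΩ)
    {u1 u2 du1 du2 ddu1 ddu2 : ℝ → ℝ} (h1 : Uicx u1) (h2 : Uicx u2)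
    (hs1 : StrictConvexOn ℝ (Set.Ici 0) u1) (hs2 : StrictConvexOn ℝ (Set.Ici 0) u2)
    (hd1 : ∀ x ∈ Set.Ici (0:ℝ), HasDerivWithinAt u1 (du1 x) (Set.Ici 0) x)
    (hd2 : ∀ x ∈ Set.Ici (0:ℝ), HasDerivWithinAt u2 (du2 x) (Set.Ici 0) x)
    (hdd1 : ∀ x ∈ Set.Ici (0:ℝ), HasDerivWithinAt du1 (ddu1 x) (Set.Ici 0) x)
    (hdd2 : ∀ x ∈ Set.Ici (0:ℝ), HasDerivWithinAt du2 (ddu2 x) (Set.Ici 0) x)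
    (hd10 : du1 0 = 0) (hd20 : du2 0 = 0)
    {α : ℝ} (hα : α ∈ Set.Ioo (0:ℝ) 1)
    (ρ : (Ω → ℝ) → (Ω → ℝ))
    (hρ : ∀ X : Ω → ℝ, BddMeas mΩ X → IsEssInf P (ArgminSet P 𝒢 u1 u2 α X) (ρ X)) :
    ((ConvexOn ℝ (Set.Ici 0) du1 ∧ ConcaveOn ℝ (Set.Ici 0) du2 ∧
        (1 - α) * ddu2 0 ≤ α * ddu1 0) →
      IsCondConvexRM P 𝒢 ρ)
    ∧ (FinitePartitionGen P 𝒢 →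
        IsCondConvexRM P 𝒢 ρ →
        ConvexOn ℝ (Set.Ici 0) du1 ∧ ConcaveOn ℝ (Set.Ici 0) du2 ∧
          (1 - α) * ddu2 0 ≤ α * ddu1 0) := by
  have hg := goodPair h1 h2 hs1 hs2 hd1 hd2 hdd1 hdd2 hd10 hd20 hα
  have hspec := rho_spec P hG (cont_comp_max hd1) (cont_comp_max hd2) hg ρ hρ
  constructor
  · rintro ⟨c1, c2, c3⟩
    exact partA P hG hg (vF_convex hdd1 hdd2 hd10 hd20 hα c1 c2 c3) ρ hspec
  · intro hfin hrm
    exact vF_convex_conv hdd1 hdd2 hd10 hd20 hα (partB P hP hG hg ρ hspec hfin hrm)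
end

section
/- Let (Ω,F,P) be a non-atomic probability space, G ⊆ F a sub-σ-algebra and α ∈ (0,1). (a) If u1(x) = u2(x) = x² and α ≥ 1/2, then the conditional generalized quantile ρ_α^G (the conditional expectile) is a conditional coherent risk measure. (b) Conversely, if G is generated by a finite measurable partition {A1,…,An} of Ω with P(Ai) > 0 for all i, u1, u2 ∈ U⁺_icx are twice differentiable and strictly convex with u1'(0) = u2'(0) = 0, and ρ_α^G is a conditional coherent risk measure, then u1(x) = u2(x) = x² and α ≥ 1/2. -/
open MeasureTheory Set Filter Topology

variable {Ω : Type*}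

section Helpers

theorem BddMeas.mono' {𝒢 mΩ : MeasurableSpace Ω} (h : 𝒢 ≤ mΩ) {Z : Ω → ℝ} (hZ : BddMeas 𝒢 Z) :
    BddMeas mΩ Z := ⟨hZ.1.mono h le_rfl, hZ.2⟩

theorem BddMeas.integrable' {mΩ : MeasurableSpace Ω} {P : Measure Ω} [IsFiniteMeasure P]
    {Z : Ω → ℝ} (hZ : BddMeas mΩ Z) : Integrable Z P := by
  obtain ⟨hm, C, hC⟩ := hZ
  exact Integrable.of_bound hm.aestronglyMeasurable C (Eventually.of_forall hC)

theorem BddMeas.comp' {mΩ : MeasurableSpace Ω} {Z : Ω → ℝ} (hZ : BddMeas mΩ Z) {g : ℝ → ℝ}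
    (hg : Continuous g) : BddMeas mΩ (fun ω => g (Z ω)) := by
  obtain ⟨hm, C, hC⟩ := hZ
  refine ⟨hg.measurable.comp hm, ?_⟩
  obtain ⟨D, hD⟩ := (isCompact_Icc (a := -C) (b := C)).exists_bound_of_continuousOn hg.continuousOn
  exact ⟨D, fun ω => hD _ (abs_le.1 (hC ω))⟩

theorem BddMeas.const' {mΩ : MeasurableSpace Ω} (c : ℝ) : BddMeas mΩ (fun _ : Ω => c) :=
  ⟨measurable_const, |c|, fun _ => le_rfl⟩

theorem BddMeas.add' {mΩ : MeasurableSpace Ω} {Y Z : Ω → ℝ} (hY : BddMeas mΩ Y)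
    (hZ : BddMeas mΩ Z) : BddMeas mΩ (fun ω => Y ω + Z ω) := by
  obtain ⟨hm, C, hC⟩ := hY
  obtain ⟨hm', C', hC'⟩ := hZ
  exact ⟨hm.add hm', C + C', fun ω => (abs_add_le _ _).trans (add_le_add (hC ω) (hC' ω))⟩

theorem BddMeas.mul' {mΩ : MeasurableSpace Ω} {Y Z : Ω → ℝ} (hY : BddMeas mΩ Y)
    (hZ : BddMeas mΩ Z) : BddMeas mΩ (fun ω => Y ω * Z ω) := by
  obtain ⟨hm, C, hC⟩ := hY
  obtain ⟨hm', C', hC'⟩ := hZ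
  refine ⟨hm.mul hm', C * C', fun ω => ?_⟩
  rw [abs_mul]
  exact mul_le_mul (hC ω) (hC' ω) (abs_nonneg _) ((abs_nonneg _).trans (hC ω))

theorem BddMeas.sub' {mΩ : MeasurableSpace Ω} {Y Z : Ω → ℝ} (hY : BddMeas mΩ Y)
    (hZ : BddMeas mΩ Z) : BddMeas mΩ (fun ω => Y ω - Z ω) := by
  obtain ⟨hm, C, hC⟩ := hY
  obtain ⟨hm', C', hC'⟩ := hZ
  exact ⟨hm.sub hm', C + C', fun ω => (abs_sub _ _).trans (add_le_add (hC ω) (hC' ω))⟩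

theorem BddMeas.ite' {mΩ : MeasurableSpace Ω} {Y Z : Ω → ℝ} (hY : BddMeas mΩ Y)
    (hZ : BddMeas mΩ Z) {A : Set Ω} (hA : MeasurableSet[mΩ] A) [DecidablePred (· ∈ A)] :
    BddMeas mΩ (fun ω => if ω ∈ A then Y ω else Z ω) := by
  obtain ⟨hm, C, hC⟩ := hY
  obtain ⟨hm', C', hC'⟩ := hZ
  refine ⟨Measurable.ite hA hm hm', max C C', fun ω => ?_⟩
  dsimp only
  split_ifs
  · exact (hC ω).trans (le_max_left _ _)
  · exact (hC' ω).trans (le_max_right _ _)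

/-- identification function of the expectile -/
noncomputable def phiE (α t : ℝ) : ℝ := α * max t 0 - (1 - α) * max (-t) 0

theorem phiE_cont (α : ℝ) : Continuous (phiE α) := by unfold phiE; fun_prop

theorem IsEssInf.nonempty' {mΩ : MeasurableSpace Ω} {P : Measure Ω} [IsProbabilityMeasure P]
    {S : Set (Ω → ℝ)} {ρ : Ω → ℝ} (h : IsEssInf P S ρ) : S.Nonempty := by
  by_contra hS
  rw [Set.not_nonempty_iff_eq_empty] at hS
  have := h.2 (fun ω => ρ ω + 1) (by simp [hS])
  have h2 : ∀ᵐ ω ∂P, False := by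
    filter_upwards [this] with ω hω
    linarith
  have h3 : P = 0 := by simpa using h2
  exact IsProbabilityMeasure.ne_zero P h3

/-- first-order condition -/
def GoodE {mΩ : MeasurableSpace Ω} (P : Measure Ω) (𝒢 : MeasurableSpace Ω) (α : ℝ)
    (X Z : Ω → ℝ) : Prop :=
  BddMeas 𝒢 Z ∧ ∀ H, BddMeas 𝒢 H → ∫ ω, phiE α (X ω - Z ω) * H ω ∂P = 0

theorem psiE_upper {α : ℝ} (h0 : 0 < α) (h1 : α < 1) (t h : ℝ) :
    α * (max (t - h) 0) ^ 2 + (1 - α) * (max (h - t) 0) ^ 2 ≤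
      α * (max t 0) ^ 2 + (1 - α) * (max (-t) 0) ^ 2 - 2 * (phiE α t * h) + h ^ 2 := by
  unfold phiE
  rcases le_total t 0 with ht | ht <;> rcases le_total (t - h) 0 with hs | hs <;>
  simp only [ht, hs, max_eq_left, max_eq_right, neg_nonneg.2, neg_nonpos.2, sub_nonneg, sub_nonpos] <;>
  simp only [sub_nonneg, sub_nonpos] at hs <;>
  simp only [sub_nonneg, sub_nonpos, hs, max_eq_left, max_eq_right] <;>
  nlinarith [mul_nonneg h0.le (sub_nonneg.2 h1.le), mul_nonneg h0.le (sq_nonneg h),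
    mul_nonneg (sub_nonneg.2 h1.le) (sq_nonneg h), mul_nonneg h0.le (sq_nonneg t),
    mul_nonneg (sub_nonneg.2 h1.le) (sq_nonneg t), mul_nonneg h0.le (sq_nonneg (t - h)),
    mul_nonneg (sub_nonneg.2 h1.le) (sq_nonneg (t - h)), mul_nonneg (sub_nonneg.2 hs) (sub_nonneg.2 ht)]

theorem goodE_of_argmin {𝒢 mΩ : MeasurableSpace Ω} {P : Measure Ω} [IsProbabilityMeasure P]
    (hG : 𝒢 ≤ mΩ) {α : ℝ} (h0 : 0 < α) (h1 : α < 1) {X Z : Ω → ℝ} (hX : BddMeas mΩ X)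
    (hZ : Z ∈ ArgminSet P 𝒢 (fun x => x ^ 2) (fun x => x ^ 2) α X) : GoodE P 𝒢 α X Z := by
  obtain ⟨hZb, hmin⟩ := hZ
  refine ⟨hZb, fun H hH => ?_⟩
  have hZ' := hZb.mono' hG
  have hH' := hH.mono' hG
  have hphi : Integrable (fun ω => phiE α (X ω - Z ω) * H ω) P :=
    (((hX.sub' hZ').comp' (phiE_cont α)).mul' hH').integrable'
  have hsq : Integrable (fun ω => H ω ^ 2) P := (hH'.comp' (continuous_pow 2)).integrable'
  have key : ∀ e : ℝ, 0 ≤ - 2 * e * ∫ ω, phiE α (X ω - Z ω) * H ω ∂P + e ^ 2 * ∫ ω, H ω ^ 2 ∂P := by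
    intro e
    have hW : BddMeas 𝒢 (fun ω => Z ω + e * H ω) := hZb.add' ((BddMeas.const' e).mul' hH)
    have hW' := hW.mono' hG
    have := hmin _ hW
    unfold piRisk at this
    have i1 : ∀ V : Ω → ℝ, BddMeas mΩ V → Integrable (fun ω => (max (X ω - V ω) 0) ^ 2) P :=
      fun V hV => ((hX.sub' hV).comp' (g := fun t => (max t 0) ^ 2) (by fun_prop)).integrable'
    have i2 : ∀ V : Ω → ℝ, BddMeas mΩ V → Integrable (fun ω => (max (V ω - X ω) 0) ^ 2) P :=
      fun V hV => ((hV.sub' hX).comp' (g := fun t => (max t 0) ^ 2) (by fun_prop)).integrable'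
    simp only [← integral_const_mul] at this ⊢
    rw [← integral_add ((i1 Z hZ').const_mul _) ((i2 Z hZ').const_mul _),
      ← integral_add ((i1 _ hW').const_mul _) ((i2 _ hW').const_mul _)] at this
    rw [← integral_add (hphi.const_mul _) (hsq.const_mul _)]
    have h3 := integral_mono (((i1 _ hW').const_mul α).add ((i2 _ hW').const_mul (1 - α)))
      ((((i1 Z hZ').const_mul α).add ((i2 Z hZ').const_mul (1 - α))).add
        ((hphi.const_mul (-2 * e)).add (hsq.const_mul (e ^ 2)))) (fun ω => by
        have := psiE_upper h0 h1 (X ω - Z ω) (e * H ω)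
        simp only [Pi.add_apply]
        have e1 : X ω - (Z ω + e * H ω) = X ω - Z ω - e * H ω := by ring
        have e2 : Z ω + e * H ω - X ω = e * H ω - (X ω - Z ω) := by ring
        have e3 : Z ω - X ω = -(X ω - Z ω) := by ring
        rw [e1, e2, e3]
        linarith)
    rw [integral_add' (((i1 Z hZ').const_mul α).add ((i2 Z hZ').const_mul (1 - α)))
        ((hphi.const_mul (-2 * e)).add (hsq.const_mul (e ^ 2)))] at h3
    simp only [Pi.add_apply] at h3
    linarith
  have hS : 0 ≤ ∫ ω, H ω ^ 2 ∂P := integral_nonneg fun ω => sq_nonneg _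
  set I := ∫ ω, phiE α (X ω - Z ω) * H ω ∂P
  set S := ∫ ω, H ω ^ 2 ∂P
  have hk := key (I / (S + 1))
  have hS1 : 0 < S + 1 := by linarith
  have e : -2 * (I / (S + 1)) * I + (I / (S + 1)) ^ 2 * S = -(I ^ 2 * (S + 2)) / (S + 1) ^ 2 := by
    field_simp; ring
  rw [e] at hk
  have : I ^ 2 * (S + 2) ≤ 0 := by
    by_contra hc
    push Not at hc
    have : -(I ^ 2 * (S + 2)) / (S + 1) ^ 2 < 0 := div_neg_of_neg_of_pos (by linarith) (by positivity)
    linarith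
  have : I ^ 2 ≤ 0 := by
    by_contra hc
    push Not at hc
    have := mul_pos hc (by linarith : 0 < S + 2)
    linarith
  exact pow_eq_zero_iff (two_ne_zero) |>.1 (le_antisymm this (sq_nonneg _))

theorem phiE_eq {α : ℝ} (h : 1 / 2 ≤ α) (t : ℝ) : phiE α t = max (α * t) ((1 - α) * t) := by
  unfold phiE
  rcases le_total t 0 with ht | ht
  · rw [max_eq_right ht, max_eq_left (by linarith), max_eq_right (by nlinarith)]; ring
  · rw [max_eq_left ht, max_eq_right (by linarith), max_eq_left (by nlinarith)]; ring

theorem phiE_mono {α : ℝ} (h1 : α < 1) (h : 1 / 2 ≤ α) {s t : ℝ} (hst : s ≤ t) :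
    phiE α s + (1 - α) * (t - s) ≤ phiE α t := by
  rw [phiE_eq h, phiE_eq h]
  rcases max_cases (α * s) ((1 - α) * s) with ⟨e, _⟩ | ⟨e, _⟩ <;> rw [e]
  · exact le_trans (by nlinarith) (le_max_left _ _)
  · exact le_trans (by nlinarith) (le_max_right _ _)

theorem phiE_convex {α : ℝ} (h : 1 / 2 ≤ α) {l s t : ℝ} (h0 : 0 ≤ l) (h1 : l ≤ 1) :
    phiE α (l * s + (1 - l) * t) ≤ l * phiE α s + (1 - l) * phiE α t := by
  rw [phiE_eq h, phiE_eq h, phiE_eq h]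
  have a1 := mul_le_mul_of_nonneg_left (le_max_left (α * s) ((1 - α) * s)) h0
  have a2 := mul_le_mul_of_nonneg_left (le_max_right (α * s) ((1 - α) * s)) h0
  have b1 := mul_le_mul_of_nonneg_left (le_max_left (α * t) ((1 - α) * t)) (sub_nonneg.2 h1)
  have b2 := mul_le_mul_of_nonneg_left (le_max_right (α * t) ((1 - α) * t)) (sub_nonneg.2 h1)
  exact max_le (by linarith) (by linarith)

theorem phiE_homog {α : ℝ} {l : ℝ} (h0 : 0 ≤ l) (t : ℝ) :
    phiE α (l * t) = l * phiE α t := by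
  unfold phiE
  have e1 : max (l * t) 0 = l * max t 0 := by rw [mul_max_of_nonneg _ _ h0, mul_zero]
  have e2 : max (-(l * t)) 0 = l * max (-t) 0 := by
    rw [mul_max_of_nonneg _ _ h0, mul_zero, mul_neg]
  rw [e1, e2]; ring

theorem goodE_le {𝒢 mΩ : MeasurableSpace Ω} {P : Measure Ω} [IsProbabilityMeasure P]
    (hG : 𝒢 ≤ mΩ) {α : ℝ} (h1 : α < 1) (h : 1 / 2 ≤ α) {X Z Z' : Ω → ℝ}
    (hX : BddMeas mΩ X) (hZ : GoodE P 𝒢 α X Z) (hZ' : BddMeas 𝒢 Z')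
    (hle : ∀ H, BddMeas 𝒢 H → (∀ ω, 0 ≤ H ω) → ∫ ω, phiE α (X ω - Z' ω) * H ω ∂P ≤ 0) :
    Z ≤ᵐ[P] Z' := by
  classical
  have hA : MeasurableSet[𝒢] {ω | Z' ω < Z ω} := measurableSet_lt hZ'.1 hZ.1.1
  have hH : BddMeas 𝒢 (fun ω => if ω ∈ {ω | Z' ω < Z ω} then (1:ℝ) else 0) :=
    (BddMeas.const' 1).ite' (BddMeas.const' 0) hA
  set H : Ω → ℝ := fun ω => if ω ∈ {ω | Z' ω < Z ω} then (1:ℝ) else 0 with hHdef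
  have a := hZ.2 H hH
  have b := hle H hH (fun ω => by simp only [hHdef]; split_ifs <;> norm_num)
  have i1 : Integrable (fun ω => phiE α (X ω - Z ω) * H ω) P :=
    (((hX.sub' (hZ.1.mono' hG)).comp' (phiE_cont α)).mul' (hH.mono' hG)).integrable'
  have i2 : Integrable (fun ω => phiE α (X ω - Z' ω) * H ω) P :=
    (((hX.sub' (hZ'.mono' hG)).comp' (phiE_cont α)).mul' (hH.mono' hG)).integrable'
  have i3 : Integrable (fun ω => max (Z ω - Z' ω) 0) P :=
    (((hZ.1.mono' hG).sub' (hZ'.mono' hG)).comp' (g := fun t => max t 0) (by fun_prop)).integrable'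
  have c := integral_mono (i1.add (i3.const_mul (1 - α))) i2 (fun ω => by
    simp only [Pi.add_apply, hHdef, Set.mem_ofPred_eq]
    split_ifs with hlt
    · have := phiE_mono h1 h (s := X ω - Z ω) (t := X ω - Z' ω) (by linarith)
      rw [max_eq_left (by linarith)]
      linarith
    · rw [max_eq_right (by linarith)]; simp)
  simp only [Pi.add_apply] at c
  rw [integral_add i1 (i3.const_mul _), integral_const_mul, a] at c
  have d : ∫ ω, max (Z ω - Z' ω) 0 ∂P = 0 := by
    have : 0 ≤ ∫ ω, max (Z ω - Z' ω) 0 ∂P := integral_nonneg fun ω => le_max_right _ _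
    by_contra hne
    have := mul_pos (by linarith : 0 < 1 - α) (lt_of_le_of_ne this (Ne.symm hne))
    linarith
  rw [integral_eq_zero_iff_of_nonneg (show 0 ≤ fun ω => max (Z ω - Z' ω) 0 from fun ω => le_max_right _ _) i3] at d
  filter_upwards [d] with ω hω
  simp only [Pi.zero_apply] at hω
  have := le_max_left (Z ω - Z' ω) 0
  linarith

theorem goodE_unique {𝒢 mΩ : MeasurableSpace Ω} {P : Measure Ω} [IsProbabilityMeasure P]
    (hG : 𝒢 ≤ mΩ) {α : ℝ} (h1 : α < 1) (h : 1 / 2 ≤ α) {X Z Z' : Ω → ℝ}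
    (hX : BddMeas mΩ X) (hZ : GoodE P 𝒢 α X Z) (hZ' : GoodE P 𝒢 α X Z') : Z =ᵐ[P] Z' :=
  (goodE_le hG h1 h hX hZ hZ'.1 (fun H hH _ => (hZ'.2 H hH).le)).antisymm
    (goodE_le hG h1 h hX hZ' hZ.1 (fun H hH _ => (hZ.2 H hH).le))

theorem partA_s14 {𝒢 mΩ : MeasurableSpace Ω} {P : Measure Ω} [IsProbabilityMeasure P]
    (hG : 𝒢 ≤ mΩ) {α : ℝ} (hα : α ∈ Set.Ioo (0:ℝ) 1) (ρ : (Ω → ℝ) → (Ω → ℝ))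
    (hρ : ∀ X : Ω → ℝ, BddMeas mΩ X →
          IsEssInf P (ArgminSet P 𝒢 (fun x => x ^ 2) (fun x => x ^ 2) α X) (ρ X))
    (h : 1 / 2 ≤ α) : IsCondCoherentRM P 𝒢 ρ := by
  obtain ⟨h0, h1⟩ := hα
  have main : ∀ X, BddMeas mΩ X → ∃ Z, GoodE P 𝒢 α X Z ∧ ρ X =ᵐ[P] Z := by
    intro X hX
    obtain ⟨Z, hZ⟩ := (hρ X hX).nonempty'
    have gZ := goodE_of_argmin hG h0 h1 hX hZ
    refine ⟨Z, gZ, ((hρ X hX).1 Z hZ).antisymm ?_⟩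
    refine (hρ X hX).2 Z (fun W hW => ?_)
    exact (goodE_unique hG h1 h hX gZ (goodE_of_argmin hG h0 h1 hX hW)).le
  have main2 : ∀ X Z, BddMeas mΩ X → GoodE P 𝒢 α X Z → ρ X =ᵐ[P] Z := by
    intro X Z hX hZ
    obtain ⟨Z', g, e⟩ := main X hX
    exact e.trans (goodE_unique hG h1 h hX g hZ)
  have ii : ∀ X Z H, BddMeas mΩ X → BddMeas 𝒢 Z → BddMeas 𝒢 H →
      Integrable (fun ω => phiE α (X ω - Z ω) * H ω) P := fun X Z H hX hZ hH =>
    (((hX.sub' (hZ.mono' hG)).comp' (phiE_cont α)).mul' (hH.mono' hG)).integrable'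
  refine ⟨⟨?_, ?_, ?_, ?_⟩, ?_⟩
  · intro X Y hX hY hXY
    obtain ⟨Z, gZ, eZ⟩ := main X hX
    obtain ⟨Z', gZ', eZ'⟩ := main Y hY
    refine eZ.le.trans (EventuallyLE.trans ?_ eZ'.symm.le)
    refine goodE_le hG h1 h hX gZ gZ'.1 (fun H hH hpos => ?_)
    rw [← gZ'.2 H hH]
    refine integral_mono_ae (ii _ _ _ hX gZ'.1 hH) (ii _ _ _ hY gZ'.1 hH) ?_
    filter_upwards [hXY] with ω hω
    refine mul_le_mul_of_nonneg_right ?_ (hpos ω)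
    have := phiE_mono h1 h (s := X ω - Z' ω) (t := Y ω - Z' ω) (by linarith)
    nlinarith
  · intro X V hX hV
    obtain ⟨Z, gZ, eZ⟩ := main X hX
    have e := main2 (fun ω => X ω + V ω) (fun ω => Z ω + V ω) (hX.add' (hV.mono' hG))
      ⟨gZ.1.add' hV, fun H hH => by simpa only [add_sub_add_right_eq_sub] using gZ.2 H hH⟩
    filter_upwards [e, eZ] with ω h1 h2
    rw [h1, h2]
  · intro X Y L hX hY hL hL01
    obtain ⟨Z, gZ, eZ⟩ := main X hX
    obtain ⟨Z', gZ', eZ'⟩ := main Y hY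
    have hL1 : BddMeas 𝒢 (fun ω => 1 - L ω) := (BddMeas.const' 1).sub' hL
    have hM : BddMeas mΩ (fun ω => L ω * X ω + (1 - L ω) * Y ω) :=
      ((hL.mono' hG).mul' hX).add' ((hL1.mono' hG).mul' hY)
    have hN : BddMeas 𝒢 (fun ω => L ω * Z ω + (1 - L ω) * Z' ω) :=
      (hL.mul' gZ.1).add' (hL1.mul' gZ'.1)
    obtain ⟨W, gW, eW⟩ := main _ hM
    have : W ≤ᵐ[P] fun ω => L ω * Z ω + (1 - L ω) * Z' ω := by
      refine goodE_le hG h1 h hM gW hN (fun H hH hpos => ?_)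
      have j1 := ii X Z _ hX gZ.1 (hL.mul' hH)
      have j2 := ii Y Z' _ hY gZ'.1 (hL1.mul' hH)
      have s1 := gZ.2 _ (hL.mul' hH)
      have s2 := gZ'.2 _ (hL1.mul' hH)
      have := integral_mono_ae (ii _ _ _ hM hN hH) (j1.add j2) (by
        filter_upwards [hL01] with ω hω
        have c := mul_le_mul_of_nonneg_right
          (phiE_convex h (s := X ω - Z ω) (t := Y ω - Z' ω) hω.1 hω.2) (hpos ω)
        have e : L ω * X ω + (1 - L ω) * Y ω - (L ω * Z ω + (1 - L ω) * Z' ω) =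
          L ω * (X ω - Z ω) + (1 - L ω) * (Y ω - Z' ω) := by ring
        simp only [Pi.add_apply]
        rw [e]
        linarith)
      simp only [Pi.add_apply] at this
      rw [integral_add j1 j2, s1, s2] at this
      linarith
    filter_upwards [this, eW, eZ, eZ'] with ω a b c d
    rw [b, c, d]; exact a
  · exact main2 _ _ (BddMeas.const' 0) ⟨BddMeas.const' 0, fun H hH => by simp [phiE]⟩
  · intro X L hX hL hL0
    obtain ⟨Z, gZ, eZ⟩ := main X hX
    have e := main2 (fun ω => L ω * X ω) (fun ω => L ω * Z ω) ((hL.mono' hG).mul' hX)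
      ⟨hL.mul' gZ.1, fun H hH => by
        rw [← gZ.2 _ (hL.mul' hH)]
        refine integral_congr_ae ?_
        filter_upwards [hL0] with ω hω
        rw [← mul_sub, phiE_homog hω]; ring⟩
    filter_upwards [e, eZ] with ω h1 h2
    rw [h1, h2]

end Helpers

section HelpersB

theorem exists_small_subset {mΩ : MeasurableSpace Ω} {P : Measure Ω} [IsProbabilityMeasure P]
    (hP : Nonatomic P) {A : Set Ω} (hA : MeasurableSet A) (h0 : 0 < P.real A) {e : ℝ} (he : 0 < e) :
    ∃ B ⊆ A, MeasurableSet B ∧ 0 < P.real B ∧ P.real B ≤ e := by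
  have half : ∀ C : Set Ω, MeasurableSet C → 0 < P.real C →
      ∃ B ⊆ C, MeasurableSet B ∧ 0 < P.real B ∧ P.real B ≤ P.real C / 2 := by
    intro C hC h
    have h' : 0 < P C := by
      rw [Measure.real, ENNReal.toReal_pos_iff] at h; exact h.1
    obtain ⟨B, hBC, hB, hB0, hB1⟩ := hP C hC h'
    have r0 : 0 < P.real B := ENNReal.toReal_pos hB0.ne' (measure_ne_top _ _)
    have r1 : P.real B < P.real C :=
      (ENNReal.toReal_lt_toReal (measure_ne_top _ _) (measure_ne_top _ _)).2 hB1
    by_cases hh : P.real B ≤ P.real C / 2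
    · exact ⟨B, hBC, hB, r0, hh⟩
    · refine ⟨C \ B, diff_subset, hC.diff hB, ?_, ?_⟩ <;>
      rw [measureReal_diff hBC hB] <;> linarith
  have iter : ∀ n : ℕ, ∃ B ⊆ A, MeasurableSet B ∧ 0 < P.real B ∧ P.real B ≤ (1 / 2) ^ n := by
    intro n
    induction n with
    | zero => exact ⟨A, Subset.rfl, hA, h0, by simpa using measureReal_le_one⟩
    | succ k ih =>
      obtain ⟨B, hBA, hB, p, q⟩ := ih
      obtain ⟨C, hCB, hC, p', q'⟩ := half B hB p
      exact ⟨C, hCB.trans hBA, hC, p', by rw [pow_succ]; linarith⟩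
  obtain ⟨n, hn⟩ := exists_pow_lt_of_lt_one he (by norm_num : (1/2:ℝ) < 1)
  obtain ⟨B, hBA, hB, p, q⟩ := iter n
  exact ⟨B, hBA, hB, p, q.trans hn.le⟩

theorem exists_subset_measure {mΩ : MeasurableSpace Ω} {P : Measure Ω} [IsProbabilityMeasure P]
    (hP : Nonatomic P) {A : Set Ω} (hA : MeasurableSet A) {t : ℝ} (h0 : 0 ≤ t)
    (ht : t ≤ P.real A) : ∃ B ⊆ A, MeasurableSet B ∧ P.real B = t := by
  let S := {B : Set Ω // MeasurableSet B ∧ B ⊆ A ∧ P.real B ≤ t}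
  have step : ∀ B : S, ∃ C : S, B.1 ⊆ C.1 ∧ ∀ D : S, B.1 ⊆ D.1 →
      P.real D.1 - P.real B.1 ≤ 2 * (P.real C.1 - P.real B.1) := by
    intro B
    let T : Set ℝ := {x | ∃ D : S, B.1 ⊆ D.1 ∧ x = P.real D.1 - P.real B.1}
    have hTb : BddAbove T := ⟨1, by
      rintro x ⟨D, _, rfl⟩
      have : P.real D.1 ≤ 1 := measureReal_le_one
      have : 0 ≤ P.real B.1 := measureReal_nonneg
      linarith⟩
    have hT0 : (0:ℝ) ∈ T := ⟨B, Subset.rfl, by simp⟩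
    have hs0 : 0 ≤ sSup T := le_csSup hTb hT0
    rcases hs0.eq_or_lt with h | h
    · refine ⟨B, Subset.rfl, fun D hD => ?_⟩
      have := le_csSup hTb (show P.real D.1 - P.real B.1 ∈ T from ⟨D, hD, rfl⟩)
      linarith
    · obtain ⟨x, ⟨C, hC, rfl⟩, hx⟩ := exists_lt_of_lt_csSup ⟨0, hT0⟩ (half_lt_self h)
      refine ⟨C, hC, fun D hD => ?_⟩
      have := le_csSup hTb (show P.real D.1 - P.real B.1 ∈ T from ⟨D, hD, rfl⟩)
      linarith
  choose F hF1 hF2 using step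
  let B : ℕ → S := fun n => F^[n] ⟨∅, MeasurableSet.empty, empty_subset _, by simpa using h0⟩
  have hBs : ∀ n, B (n + 1) = F (B n) := fun n => Function.iterate_succ_apply' F n _
  have hmono : Monotone (fun n => (B n).1) := monotone_nat_of_le_succ fun n => by
    rw [hBs]; exact hF1 _
  have hlim : Tendsto (fun n => P.real (B n).1) atTop (𝓝 (P.real (⋃ n, (B n).1))) := by
    have := tendsto_measure_iUnion_atTop (μ := P) hmono
    exact (ENNReal.tendsto_toReal (measure_ne_top _ _)).comp this
  have hle : P.real (⋃ n, (B n).1) ≤ t := le_of_tendsto' hlim fun n => (B n).2.2.2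
  have hU : MeasurableSet (⋃ n, (B n).1) := MeasurableSet.iUnion fun n => (B n).2.1
  have hUA : (⋃ n, (B n).1) ⊆ A := iUnion_subset fun n => (B n).2.2.1
  refine ⟨_, hUA, hU, ?_⟩
  by_contra hne
  have hlt : P.real (⋃ n, (B n).1) < t := lt_of_le_of_ne hle hne
  obtain ⟨E, hE1, hE2, hE3, hE4⟩ := exists_small_subset hP (hA.diff hU)
    (by rw [measureReal_diff hUA hU]; linarith) (sub_pos.2 hlt)
  have hstep : ∀ n, P.real E ≤ 2 * (P.real (B (n + 1)).1 - P.real (B n).1) := by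
    intro n
    have hd : Disjoint (B n).1 E := by
      refine (disjoint_sdiff_right.mono_left ?_).mono_right hE1
      exact subset_iUnion (fun n => (B n).1) n
    have hm : P.real ((B n).1 ∪ E) = P.real (B n).1 + P.real E := measureReal_union hd hE2
    have hBn : P.real (B n).1 ≤ P.real (⋃ n, (B n).1) :=
      measureReal_mono (subset_iUnion (fun n => (B n).1) n)
    have := hF2 (B n) ⟨(B n).1 ∪ E, (B n).2.1.union hE2,
      union_subset (B n).2.2.1 (hE1.trans diff_subset), by rw [hm]; linarith⟩ subset_union_left
    rw [hBs]
    simp only [hm] at this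
    linarith
  have hlim2 : Tendsto (fun n => 2 * (P.real (B (n + 1)).1 - P.real (B n).1)) atTop (𝓝 (2 * 0)) := by
    have := ((hlim.comp (tendsto_add_atTop_nat 1)).sub hlim).const_mul 2
    rw [sub_self] at this
    exact this
  have := ge_of_tendsto' hlim2 hstep
  linarith

/-- An atom (cell) of `𝒢`. -/
def IsCell (𝒢 : MeasurableSpace Ω) (A : Set Ω) : Prop :=
  MeasurableSet[𝒢] A ∧ ∀ S, MeasurableSet[𝒢] S → A ⊆ S ∨ Disjoint A S

theorem isCell_of_partition {n : ℕ} (A : Fin n → Set Ω)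
    (hd : Pairwise (Function.onFun Disjoint A)) (i : Fin n) :
    IsCell (MeasurableSpace.generateFrom {s | ∃ i, s = A i}) (A i) := by
  refine ⟨MeasurableSpace.measurableSet_generateFrom ⟨i, rfl⟩, fun S hS => ?_⟩
  induction S, hS using MeasurableSpace.generateFrom_induction with
  | hC t ht _ =>
    obtain ⟨j, rfl⟩ := ht
    by_cases h : i = j
    · left; rw [h]
    · right; exact hd h
  | empty => right; simp
  | compl t _ ih =>
    rcases ih with h | h
    · right; exact disjoint_compl_right.mono_left h
    · left; exact h.subset_compl_right
  | iUnion f _ ih =>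
    by_cases h : ∃ k, A i ⊆ f k
    · obtain ⟨k, hk⟩ := h
      left; exact hk.trans (subset_iUnion f k)
    · right
      push Not at h
      exact disjoint_iUnion_right.2 fun k => (ih k).resolve_left (h k)

theorem IsCell.const {𝒢 : MeasurableSpace Ω} {A : Set Ω} (hA : IsCell 𝒢 A) {Z : Ω → ℝ}
    (hZ : Measurable[𝒢] Z) {a b : Ω} (ha : a ∈ A) (hb : b ∈ A) : Z b = Z a := by
  rcases hA.2 (Z ⁻¹' {Z a}) (hZ (measurableSet_singleton _)) with h | h
  · exact h hb
  · exact absurd rfl (fun h' : Z a = Z a => Set.disjoint_left.1 h ha h')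

open Classical in
/-- Three-valued random variable on the cell `A`. -/
noncomputable def X3 (A B C : Set Ω) (x y w : ℝ) (ω : Ω) : ℝ :=
  if ω ∈ B then x else if ω ∈ C then y else if ω ∈ A then w else 0

theorem X3_bdd {mΩ : MeasurableSpace Ω} {A B C : Set Ω} (hA : MeasurableSet A)
    (hB : MeasurableSet B) (hC : MeasurableSet C) (x y w : ℝ) : BddMeas mΩ (X3 A B C x y w) := by
  classical
  have := (BddMeas.const' x).ite' ((BddMeas.const' y).ite'
    ((BddMeas.const' w).ite' (BddMeas.const' 0) hA) hC) hB
  unfold X3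
  convert this

theorem X3_integral {mΩ : MeasurableSpace Ω} {P : Measure Ω} [IsProbabilityMeasure P]
    {A B C : Set Ω} (hA : MeasurableSet A)
    (hB : MeasurableSet B) (hC : MeasurableSet C) (hBA : B ⊆ A) (hCA : C ⊆ A) (hBC : Disjoint B C)
    (x y w : ℝ) (F : ℝ → ℝ) :
    ∫ ω in A, F (X3 A B C x y w ω) ∂P =
      P.real B * F x + P.real C * F y + (P.real A - P.real B - P.real C) * F w := by
  have e : ∀ ω ∈ A, F (X3 A B C x y w ω) =
      F w + (B.indicator (fun _ => F x - F w) ω + C.indicator (fun _ => F y - F w) ω) := by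
    intro ω hω
    unfold X3
    by_cases h1 : ω ∈ B
    · have h2 : ω ∉ C := Set.disjoint_left.1 hBC h1
      simp [h1, h2]
    · by_cases h2 : ω ∈ C <;> simp [h1, h2, hω]
  rw [setIntegral_congr_fun hA e]
  have iB : Integrable (B.indicator (fun _ => F x - F w)) (P.restrict A) :=
    (integrable_const _).indicator hB
  have iC : Integrable (C.indicator (fun _ => F y - F w)) (P.restrict A) :=
    (integrable_const _).indicator hC
  have iBC : Integrable (fun ω => B.indicator (fun _ => F x - F w) ω +
    C.indicator (fun _ => F y - F w) ω) (P.restrict A) := iB.add iC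
  rw [integral_add (integrable_const _) iBC, integral_add iB iC, integral_indicator_const _ hB,
    integral_indicator_const _ hC, integral_const, measureReal_restrict_apply hB,
    measureReal_restrict_apply hC, inter_eq_left.2 hBA, inter_eq_left.2 hCA]
  simp
  ring

theorem cell_min {𝒢 mΩ : MeasurableSpace Ω} {P : Measure Ω} [IsProbabilityMeasure P]
    (hG : 𝒢 ≤ mΩ) {α : ℝ} {u1 u2 v : ℝ → ℝ} (hc1 : Continuous fun t => u1 (max t 0))
    (hc2 : Continuous fun t => u2 (max t 0))
    (hsub : ∀ s t, α * u1 (max t 0) + (1 - α) * u2 (max (-t) 0) + v t * (s - t) ≤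
      α * u1 (max s 0) + (1 - α) * u2 (max (-s) 0))
    {A B C : Set Ω} (hA : IsCell 𝒢 A)
    (hB : MeasurableSet[mΩ] B) (hC : MeasurableSet[mΩ] C) (hBA : B ⊆ A) (hCA : C ⊆ A)
    (hBC : Disjoint B C) (x y w : ℝ)
    {Z : Ω → ℝ} (hZ : Z ∈ ArgminSet P 𝒢 u1 u2 α (X3 A B C x y w)) (d : ℝ) {a : Ω} (ha : a ∈ A) :
    0 ≤ (Z a - d) * (P.real B * v (x - d) + P.real C * v (y - d) +
      (P.real A - P.real B - P.real C) * v (w - d)) := by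
  classical
  obtain ⟨hZb, hmin⟩ := hZ
  have hAm : MeasurableSet[mΩ] A := hG _ hA.1
  set X := X3 A B C x y w with hXdef
  have hX : BddMeas mΩ X := X3_bdd hAm hB hC x y w
  have hW : BddMeas 𝒢 (fun ω => if ω ∈ A then d else Z ω) := (BddMeas.const' d).ite' hZb hA.1
  have hm := hmin _ hW
  set W := (fun ω => if ω ∈ A then d else Z ω) with hWdef
  set ψ : ℝ → ℝ := fun t => α * u1 (max t 0) + (1 - α) * u2 (max (-t) 0) with hψ
  have hψc : Continuous ψ := by
    have := hc2.comp continuous_neg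
    exact (hc1.const_mul α).add (this.const_mul (1 - α))
  have hpi : ∀ V, BddMeas mΩ V → piRisk P u1 u2 α X V = ∫ ω, ψ (X ω - V ω) ∂P := by
    intro V hV
    unfold piRisk
    rw [← integral_const_mul, ← integral_const_mul, ← integral_add
      (((hX.sub' hV).comp' hc1).integrable'.const_mul _)
      (((hV.sub' hX).comp' hc2).integrable'.const_mul _)]
    simp only [hψ, neg_sub]
  rw [hpi _ (hZb.mono' hG), hpi _ (hW.mono' hG),
    ← integral_add_compl hAm ((hX.sub' (hZb.mono' hG)).comp' hψc).integrable',
    ← integral_add_compl hAm ((hX.sub' (hW.mono' hG)).comp' hψc).integrable'] at hm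
  have e1 : ∫ ω in Aᶜ, ψ (X ω - W ω) ∂P = ∫ ω in Aᶜ, ψ (X ω - Z ω) ∂P := by
    refine setIntegral_congr_fun hAm.compl fun ω hω => ?_
    simp only [hWdef, if_neg hω]
  have e2 : ∫ ω in A, ψ (X ω - W ω) ∂P = ∫ ω in A, (fun r => ψ (r - d)) (X ω) ∂P := by
    refine setIntegral_congr_fun hAm fun ω hω => ?_
    simp only [hWdef, if_pos hω]
  have e3 : ∫ ω in A, ψ (X ω - Z ω) ∂P = ∫ ω in A, (fun r => ψ (r - Z a)) (X ω) ∂P := by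
    refine setIntegral_congr_fun hAm fun ω hω => ?_
    simp only [hA.const hZb.1 ha hω]
  rw [e1, e2, e3, hXdef, X3_integral hAm hB hC hBA hCA hBC x y w (fun r => ψ (r - Z a)),
    X3_integral hAm hB hC hBA hCA hBC x y w (fun r => ψ (r - d))] at hm
  have s : ∀ r, ψ (r - d) - v (r - d) * (Z a - d) ≤ ψ (r - Z a) := by
    intro r
    have := hsub (r - Z a) (r - d)
    simp only [hψ]
    nlinarith
  have p1 : 0 ≤ P.real B := measureReal_nonneg
  have p2 : 0 ≤ P.real C := measureReal_nonneg
  have p3 : 0 ≤ P.real A - P.real B - P.real C := by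
    have h1 : P.real (B ∪ C) = P.real B + P.real C := measureReal_union hBC hC
    have h2 : P.real (B ∪ C) ≤ P.real A := measureReal_mono (union_subset hBA hCA)
    linarith
  have t1 := mul_le_mul_of_nonneg_left (s x) p1
  have t2 := mul_le_mul_of_nonneg_left (s y) p2
  have t3 := mul_le_mul_of_nonneg_left (s w) p3
  nlinarith

theorem cell_rho {mΩ : MeasurableSpace Ω} {P : Measure Ω} [IsProbabilityMeasure P]
    {A : Set Ω} (hA : 0 < P.real A) {S : Set (Ω → ℝ)} {ρ : Ω → ℝ} (hρ : IsEssInf P S ρ)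
    {D : ℝ → ℝ} (hD : StrictAnti D) (hDc : Continuous D)
    (hS : ∀ Z ∈ S, ∀ d : ℝ, ∀ a ∈ A, 0 ≤ (Z a - d) * D d) :
    (D 0 = 0 → ∀ᵐ ω ∂P, ω ∈ A → ρ ω = 0) ∧
    ((∀ᵐ ω ∂P, ω ∈ A → ρ ω ≤ 0) → D 0 ≤ 0) ∧
    ((∀ᵐ ω ∂P, ω ∈ A → 0 ≤ ρ ω) → 0 ≤ D 0) := by
  classical
  have L : ∀ d, 0 < D d → ∀ᵐ ω ∂P, ω ∈ A → d ≤ ρ ω := by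
    intro d hd
    have := hρ.2 (fun ω => if ω ∈ A then d else ρ ω) (fun Z hZ => by
      filter_upwards [hρ.1 Z hZ] with ω hω
      split_ifs with h
      · have := nonneg_of_mul_nonneg_left (hS Z hZ d ω h) hd
        linarith
      · exact hω)
    filter_upwards [this] with ω hω h
    rwa [if_pos h] at hω
  have U : ∀ d, D d < 0 → ∀ᵐ ω ∂P, ω ∈ A → ρ ω ≤ d := by
    intro d hd
    obtain ⟨Z, hZ⟩ := hρ.nonempty'
    filter_upwards [hρ.1 Z hZ] with ω hω h
    have := hS Z hZ d ω h
    by_contra hc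
    push Not at hc
    have : (Z ω - d) * D d < 0 := mul_neg_of_pos_of_neg (by linarith) hd
    linarith
  have contra : ¬ ∀ᵐ ω ∂P, ω ∉ A := by
    intro h
    rw [ae_iff] at h
    simp only [not_not] at h
    have : P A = 0 := h
    simp [Measure.real, this] at hA
  refine ⟨fun h0 => ?_, fun h => ?_, fun h => ?_⟩
  · have hU : ∀ᵐ ω ∂P, ∀ n : ℕ, ω ∈ A → ρ ω ≤ 1 / ((n:ℝ) + 1) := by
      rw [ae_all_iff]
      intro n
      refine U _ ?_
      rw [← h0]
      exact hD (by positivity)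
    have hL : ∀ᵐ ω ∂P, ∀ n : ℕ, ω ∈ A → -(1 / ((n:ℝ) + 1)) ≤ ρ ω := by
      rw [ae_all_iff]
      intro n
      refine L _ ?_
      rw [← h0]
      exact hD (neg_neg_of_pos (by positivity))
    filter_upwards [hU, hL] with ω h1 h2 h
    have t := tendsto_one_div_add_atTop_nhds_zero_nat (𝕜 := ℝ)
    refine le_antisymm (ge_of_tendsto' t fun n => h1 n h) ?_
    have := le_of_tendsto' t.neg fun n => h2 n h
    simpa using this
  · by_contra hc
    push Not at hc
    have ev : ∀ᶠ d in 𝓝[>] (0:ℝ), 0 < D d :=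
      (hDc.continuousAt.eventually (lt_mem_nhds hc)).filter_mono nhdsWithin_le_nhds
    obtain ⟨d, hd, hd0⟩ := (ev.and self_mem_nhdsWithin).exists
    refine contra ?_
    filter_upwards [h, L d hd] with ω h1 h2 h3
    have := h1 h3
    have := h2 h3
    have : 0 < d := hd0
    linarith
  · by_contra hc
    push Not at hc
    have ev : ∀ᶠ d in 𝓝[<] (0:ℝ), D d < 0 :=
      (hDc.continuousAt.eventually (gt_mem_nhds hc)).filter_mono nhdsWithin_le_nhds
    obtain ⟨d, hd, hd0⟩ := (ev.and self_mem_nhdsWithin).exists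
    refine contra ?_
    filter_upwards [h, U d hd] with ω h1 h2 h3
    have := h1 h3
    have := h2 h3
    have : d < 0 := hd0
    linarith

end HelpersB

section HelpersC

theorem subgrad {u f : ℝ → ℝ} (hu : ConvexOn ℝ (Ici 0) u)
    (hd : ∀ x ∈ Ici (0:ℝ), HasDerivWithinAt u (f x) (Ici 0) x) {s t : ℝ} (hs : 0 ≤ s) (ht : 0 ≤ t) :
    u t + f t * (s - t) ≤ u s := by
  rcases lt_trichotomy s t with h | h | h
  · have := hu.slope_le_of_hasDerivWithinAt (mem_Ici.2 hs) (mem_Ici.2 ht) h (hd t ht)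
    rw [slope_def_field, div_le_iff₀ (by linarith)] at this
    linarith
  · subst h; simp
  · have := hu.le_slope_of_hasDerivWithinAt (mem_Ici.2 ht) (mem_Ici.2 hs) h (hd t ht)
    rw [slope_def_field, le_div_iff₀ (by linarith)] at this
    linarith

theorem deriv_strict {u f : ℝ → ℝ} (hu : StrictConvexOn ℝ (Ici 0) u)
    (hd : ∀ x ∈ Ici (0:ℝ), HasDerivWithinAt u (f x) (Ici 0) x) : StrictMonoOn f (Ici 0) := by
  intro s hs t ht h
  exact (hu.lt_slope_of_hasDerivWithinAt hs ht h (hd s hs)).trans_le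
    (hu.convexOn.slope_le_of_hasDerivWithinAt hs ht h (hd t ht))

theorem linear_of_double {f : ℝ → ℝ} (h0 : f 0 = 0)
    (hd : DifferentiableWithinAt ℝ f (Ici 0) 0) (h2 : ∀ t, 0 ≤ t → f (2 * t) = 2 * f t) :
    ∃ c, ∀ t, 0 ≤ t → f t = c * t := by
  refine ⟨derivWithin f (Ici 0) 0, fun t ht => ?_⟩
  rcases ht.eq_or_lt with rfl | ht
  · simp [h0]
  have hs := hd.hasDerivWithinAt
  rw [hasDerivWithinAt_iff_tendsto_slope] at hs
  have hseq : Tendsto (fun n : ℕ => t * (1 / 2) ^ n) atTop (𝓝[Ici 0 \ {0}] 0) := by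
    rw [tendsto_nhdsWithin_iff]
    constructor
    · have := (tendsto_pow_atTop_nhds_zero_of_lt_one (by norm_num : (0:ℝ) ≤ 1 / 2)
        (by norm_num)).const_mul t
      simpa using this
    · refine Eventually.of_forall fun n => ?_
      have : 0 < t * (1 / 2) ^ n := by positivity
      exact ⟨this.le, this.ne'⟩
  have hc := hs.comp hseq
  have hv : ∀ n : ℕ, f (t * (1 / 2) ^ n) = f t * (1 / 2) ^ n := by
    intro n
    induction n with
    | zero => simp
    | succ k ih =>
      have := h2 (t * (1 / 2) ^ (k + 1)) (by positivity)
      have e : 2 * (t * (1 / 2 : ℝ) ^ (k + 1)) = t * (1 / 2) ^ k := by rw [pow_succ]; ring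
      rw [e, ih] at this
      have e2 : f t * (1 / 2 : ℝ) ^ (k + 1) = f t * (1 / 2) ^ k / 2 := by rw [pow_succ]; ring
      rw [e2]; linarith
  have hconst : (slope f 0 ∘ fun n : ℕ => t * (1 / 2) ^ n) = fun _ => f t / t := by
    funext n
    simp only [Function.comp, slope_def_field, hv, h0, sub_zero]
    field_simp
  rw [hconst] at hc
  have := tendsto_nhds_unique hc tendsto_const_nhds
  rw [this]
  field_simp

theorem quad_of_linear {u f : ℝ → ℝ} {c : ℝ}
    (hd : ∀ x ∈ Ici (0:ℝ), HasDerivWithinAt u (f x) (Ici 0) x) (hf : ∀ t, 0 ≤ t → f t = c * t)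
    (h0 : u 0 = 0) (h1 : u 1 = 1) : c = 2 ∧ ∀ x ∈ Ici (0:ℝ), u x = x ^ 2 := by
  have key : ∀ x, 0 ≤ x → u x = c / 2 * x ^ 2 := by
    intro x hx
    have hD : ∀ y ∈ Ici (0:ℝ), HasDerivWithinAt (fun z => u z - c / 2 * z ^ 2) 0 (Ici 0) y := by
      intro y hy
      have a := hd y hy
      have b : HasDerivWithinAt (fun z : ℝ => c / 2 * z ^ 2) (c / 2 * (2 * y)) (Ici 0) y := by
        simpa using ((hasDerivAt_pow 2 y).const_mul (c / 2)).hasDerivWithinAt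
      have := a.sub b
      rw [hf y hy] at this
      have e : c * y - c / 2 * (2 * y) = 0 := by ring
      rwa [e] at this
    have := constant_of_has_deriv_right_zero (f := fun z => u z - c / 2 * z ^ 2) (a := 0) (b := x)
      (fun y hy => (hD y hy.1).continuousWithinAt.mono Icc_subset_Ici_self)
      (fun y hy => (hD y hy.1).mono (Ici_subset_Ici.2 hy.1)) x ⟨hx, le_rfl⟩
    simp only [h0] at this
    linarith
  have hc : c = 2 := by
    have := key 1 zero_le_one
    rw [h1] at this
    linarith
  refine ⟨hc, fun x hx => ?_⟩
  rw [key x hx, hc]; ring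

theorem exists_weight {p σ τ : ℝ} (hp : 0 < p)
    (h : (0 < σ ∧ τ < 0) ∨ (σ < 0 ∧ 0 < τ) ∨ (σ = 0 ∧ τ = 0)) :
    ∃ b, 0 < b ∧ 2 * b < p ∧ b * σ + (p - 2 * b) * τ = 0 := by
  rcases h with ⟨h1, h2⟩ | ⟨h1, h2⟩ | ⟨h1, h2⟩
  · have hd : 0 < σ - 2 * τ := by linarith
    have hd' := hd.ne'
    refine ⟨p * (-τ) / (σ - 2 * τ), div_pos (mul_pos hp (by linarith)) hd, ?_, ?_⟩
    · rw [← mul_div_assoc, div_lt_iff₀ hd]; nlinarith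
    · have := div_mul_cancel₀ (p * (-τ)) hd'
      linear_combination this
  · have hd : 0 < 2 * τ - σ := by linarith
    have hd' := hd.ne'
    refine ⟨p * τ / (2 * τ - σ), div_pos (mul_pos hp (by linarith)) hd, ?_, ?_⟩
    · rw [← mul_div_assoc, div_lt_iff₀ hd]; nlinarith
    · have := div_mul_cancel₀ (p * τ) hd'
      linear_combination -this
  · exact ⟨p / 4, by linarith, by linarith, by rw [h1, h2]; ring⟩

theorem partB_s14 {𝒢 mΩ : MeasurableSpace Ω} {P : Measure Ω} [IsProbabilityMeasure P]
    (hP : Nonatomic P) (hG : 𝒢 ≤ mΩ) {α : ℝ} (hα : α ∈ Set.Ioo (0:ℝ) 1)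
    (u1 u2 f g : ℝ → ℝ) (hu1 : Uicx u1) (hu2 : Uicx u2)
    (hs1 : StrictConvexOn ℝ (Set.Ici 0) u1) (hs2 : StrictConvexOn ℝ (Set.Ici 0) u2)
    (hd1 : ∀ x ∈ Set.Ici (0:ℝ), HasDerivWithinAt u1 (f x) (Set.Ici 0) x)
    (hd2 : ∀ x ∈ Set.Ici (0:ℝ), HasDerivWithinAt u2 (g x) (Set.Ici 0) x)
    (hdd1 : ∀ x ∈ Set.Ici (0:ℝ), DifferentiableWithinAt ℝ f (Set.Ici 0) x)
    (hdd2 : ∀ x ∈ Set.Ici (0:ℝ), DifferentiableWithinAt ℝ g (Set.Ici 0) x)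
    (hf0 : f 0 = 0) (hg0 : g 0 = 0) (hfp : FinitePartitionGen P 𝒢)
    (ρ : (Ω → ℝ) → (Ω → ℝ))
    (hρ : ∀ X : Ω → ℝ, BddMeas mΩ X → IsEssInf P (ArgminSet P 𝒢 u1 u2 α X) (ρ X))
    (hcoh : IsCondCoherentRM P 𝒢 ρ) :
    (∀ x ∈ Set.Ici (0:ℝ), u1 x = x ^ 2) ∧ (∀ x ∈ Set.Ici (0:ℝ), u2 x = x ^ 2) ∧ 1 / 2 ≤ α := by
  obtain ⟨h0, h1⟩ := hα
  -- a cell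
  obtain ⟨A, hA, hp⟩ : ∃ A, IsCell 𝒢 A ∧ 0 < P.real A := by
    obtain ⟨n, A, _, hpos, hdis, hun, rfl⟩ := hfp
    obtain ⟨ω⟩ : Nonempty Ω := nonempty_of_isProbabilityMeasure P
    have : ω ∈ ⋃ i, A i := hun ▸ mem_univ ω
    obtain ⟨i, _⟩ := mem_iUnion.1 this
    exact ⟨A i, isCell_of_partition A hdis i,
      ENNReal.toReal_pos (hpos i).ne' (measure_ne_top _ _)⟩
  have hAm : MeasurableSet[mΩ] A := hG _ hA.1
  have hcf : Continuous fun t => f (max t 0) :=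
    ContinuousOn.comp_continuous (s := Ici 0) (fun x hx => (hdd1 x hx).continuousWithinAt)
      (by fun_prop) (fun t => mem_Ici.2 (le_max_right _ _))
  have hcg : Continuous fun t => g (max t 0) :=
    ContinuousOn.comp_continuous (s := Ici 0) (fun x hx => (hdd2 x hx).continuousWithinAt)
      (by fun_prop) (fun t => mem_Ici.2 (le_max_right _ _))
  have hc1 : Continuous fun t => u1 (max t 0) :=
    ContinuousOn.comp_continuous (s := Ici 0) (fun x hx => (hd1 x hx).continuousWithinAt)
      (by fun_prop) (fun t => mem_Ici.2 (le_max_right _ _))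
  have hc2 : Continuous fun t => u2 (max t 0) :=
    ContinuousOn.comp_continuous (s := Ici 0) (fun x hx => (hd2 x hx).continuousWithinAt)
      (by fun_prop) (fun t => mem_Ici.2 (le_max_right _ _))
  have fm := deriv_strict hs1 hd1
  have gm := deriv_strict hs2 hd2
  have fpos : ∀ t, 0 < t → 0 < f t := fun t ht => by
    have := fm (mem_Ici.2 le_rfl) (mem_Ici.2 ht.le) ht
    rwa [hf0] at this
  have gpos : ∀ t, 0 < t → 0 < g t := fun t ht => by
    have := gm (mem_Ici.2 le_rfl) (mem_Ici.2 ht.le) ht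
    rwa [hg0] at this
  obtain ⟨v, hv⟩ : ∃ v : ℝ → ℝ, ∀ t, v t = α * f (max t 0) - (1 - α) * g (max (-t) 0) :=
    ⟨_, fun _ => rfl⟩
  have vpos : ∀ t, 0 ≤ t → v t = α * f t := fun t ht => by
    rw [hv, max_eq_left ht, max_eq_right (by linarith), hg0]; ring
  have vneg : ∀ t, 0 ≤ t → v (-t) = -((1 - α) * g t) := fun t ht => by
    rw [hv, neg_neg, max_eq_left ht, max_eq_right (by linarith), hf0]; ring
  have v0 : v 0 = 0 := by rw [vpos 0 le_rfl, hf0, mul_zero]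
  have vc : Continuous v := by
    have e : v = fun t => α * f (max t 0) - (1 - α) * g (max (-t) 0) := funext hv
    rw [e]
    exact (hcf.const_mul α).sub ((hcg.comp continuous_neg).const_mul (1 - α))
  have hα1 : 0 < 1 - α := by linarith
  have vm : StrictMono v := by
    intro s t hst
    rcases le_or_gt 0 s with hs | hs
    · rw [vpos s hs, vpos t (hs.trans hst.le)]
      exact mul_lt_mul_of_pos_left (fm hs (hs.trans hst.le) hst) h0
    · have es := vneg (-s) (by linarith)
      rw [neg_neg] at es
      have := mul_pos hα1 (gpos (-s) (by linarith))
      rcases le_or_gt 0 t with ht | ht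
      · rw [es, vpos t ht]
        have : 0 ≤ f t := by
          rcases ht.eq_or_lt with h | h
          · rw [← h, hf0]
          · exact (fpos t h).le
        have := mul_nonneg h0.le this
        linarith
      · have et := vneg (-t) (by linarith)
        rw [neg_neg] at et
        rw [es, et]
        have := mul_lt_mul_of_pos_left (gm (mem_Ici.2 (by linarith : 0 ≤ -t))
          (mem_Ici.2 (by linarith : 0 ≤ -s)) (by linarith)) hα1
        linarith
  have u1nn : ∀ t, 0 ≤ t → 0 ≤ u1 t := fun t ht => by
    have := hu1.1.monotoneOn (mem_Ici.2 le_rfl) (mem_Ici.2 ht) ht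
    rwa [hu1.2.2.1] at this
  have u2nn : ∀ t, 0 ≤ t → 0 ≤ u2 t := fun t ht => by
    have := hu2.1.monotoneOn (mem_Ici.2 le_rfl) (mem_Ici.2 ht) ht
    rwa [hu2.2.2.1] at this
  have hsub : ∀ s t, α * u1 (max t 0) + (1 - α) * u2 (max (-t) 0) + v t * (s - t) ≤
      α * u1 (max s 0) + (1 - α) * u2 (max (-s) 0) := by
    intro s t
    have q1 := mul_le_mul_of_nonneg_left
      (subgrad hu1.2.1 hd1 (s := max s 0) (t := max t 0) (le_max_right _ _) (le_max_right _ _)) h0.le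
    have q2 := mul_le_mul_of_nonneg_left
      (subgrad hu2.2.1 hd2 (s := max (-s) 0) (t := max (-t) 0) (le_max_right _ _) (le_max_right _ _))
      hα1.le
    have f1 : 0 ≤ f (max t 0) := by
      rcases (le_max_right t 0).eq_or_lt with h | h
      · rw [← h, hf0]
      · exact (fpos _ h).le
    have g1 : 0 ≤ g (max (-t) 0) := by
      rcases (le_max_right (-t) 0).eq_or_lt with h | h
      · rw [← h, hg0]
      · exact (gpos _ h).le
    have r1 : f (max t 0) * (s - t) ≤ f (max t 0) * (max s 0 - max t 0) := by
      rcases le_total t 0 with ht | ht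
      · rw [max_eq_right ht, hf0]; simp
      · rw [max_eq_left ht] at f1 ⊢
        exact mul_le_mul_of_nonneg_left (by linarith [le_max_left s 0]) f1
    have r2 : g (max (-t) 0) * (t - s) ≤ g (max (-t) 0) * (max (-s) 0 - max (-t) 0) := by
      rcases le_total 0 t with ht | ht
      · rw [max_eq_right (by linarith : -t ≤ 0), hg0]; simp
      · rw [max_eq_left (by linarith : 0 ≤ -t)] at g1 ⊢
        exact mul_le_mul_of_nonneg_left (by linarith [le_max_left (-s) 0]) g1
    have r1' := mul_le_mul_of_nonneg_left r1 h0.le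
    have r2' := mul_le_mul_of_nonneg_left r2 hα1.le
    rw [hv]
    linarith
  -- sets with given weights
  have sets : ∀ b, 0 < b → 2 * b < P.real A → ∃ B C : Set Ω, MeasurableSet[mΩ] B ∧
      MeasurableSet[mΩ] C ∧ B ⊆ A ∧ C ⊆ A ∧ Disjoint B C ∧ P.real B = b ∧ P.real C = b := by
    intro b hb hb2
    obtain ⟨B, hBA, hB, eB⟩ := exists_subset_measure hP hAm hb.le (by linarith : b ≤ P.real A)
    obtain ⟨C, hCA, hC, eC⟩ := exists_subset_measure hP (hAm.diff hB) hb.le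
      (by rw [measureReal_diff hBA hB]; linarith : b ≤ P.real (A \ B))
    exact ⟨B, C, hB, hC, hBA, hCA.trans diff_subset, disjoint_sdiff_right.mono_right hCA, eB, eC⟩
  have crit : ∀ b, 0 < b → 2 * b < P.real A → ∀ B C : Set Ω, MeasurableSet[mΩ] B →
      MeasurableSet[mΩ] C → B ⊆ A → C ⊆ A → Disjoint B C → P.real B = b → P.real C = b →
      ∀ x y w : ℝ,
      (b * (v x + v y) + (P.real A - 2 * b) * v w = 0 →
        ∀ᵐ ω ∂P, ω ∈ A → ρ (X3 A B C x y w) ω = 0) ∧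
      ((∀ᵐ ω ∂P, ω ∈ A → ρ (X3 A B C x y w) ω ≤ 0) →
        b * (v x + v y) + (P.real A - 2 * b) * v w ≤ 0) ∧
      ((∀ᵐ ω ∂P, ω ∈ A → 0 ≤ ρ (X3 A B C x y w) ω) →
        0 ≤ b * (v x + v y) + (P.real A - 2 * b) * v w) := by
    intro b hb hb2 B C hB hC hBA hCA hBC eB eC x y w
    have := cell_rho hp (hρ _ (X3_bdd hAm hB hC x y w))
      (D := fun d => b * (v (x - d) + v (y - d)) + (P.real A - 2 * b) * v (w - d)) ?_ ?_ ?_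
    · simpa only [sub_zero] using this
    · intro s t hst
      have a1 := mul_lt_mul_of_pos_left (vm (by linarith : x - t < x - s)) hb
      have a2 := mul_lt_mul_of_pos_left (vm (by linarith : y - t < y - s)) hb
      have a3 := mul_lt_mul_of_pos_left (vm (by linarith : w - t < w - s))
        (by linarith : 0 < P.real A - 2 * b)
      dsimp only
      linarith
    · fun_prop
    · intro Z hZ d a ha
      have := cell_min hG hc1 hc2 hsub hA hB hC hBA hCA hBC x y w hZ d ha
      rw [eB, eC] at this
      convert this using 2
      ring
  have mid : ∀ x y, v ((x + y) / 2) ≤ (v x + v y) / 2 := by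
    intro x y
    obtain ⟨w, hw⟩ : ∃ w, (0 < v x + v y ∧ v w < 0) ∨ (v x + v y < 0 ∧ 0 < v w) ∨
        (v x + v y = 0 ∧ v w = 0) := by
      rcases lt_trichotomy (v x + v y) 0 with h | h | h
      · exact ⟨1, Or.inr (Or.inl ⟨h, by rw [← v0]; exact vm one_pos⟩)⟩
      · exact ⟨0, Or.inr (Or.inr ⟨h, v0⟩)⟩
      · exact ⟨-1, Or.inl ⟨h, by rw [← v0]; exact vm (by norm_num)⟩⟩
    obtain ⟨b, hb, hb2, hbe⟩ := exists_weight hp hw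
    obtain ⟨B, C, hB, hC, hBA, hCA, hBC, eB, eC⟩ := sets b hb hb2
    have cr := crit b hb hb2 B C hB hC hBA hCA hBC eB eC
    have z1 := (cr x y w).1 hbe
    have z2 := (cr y x w).1 (by rw [add_comm (v y)]; exact hbe)
    have cv := hcoh.1.2.2.1 (X3 A B C x y w) (X3 A B C y x w) (fun _ => 1 / 2)
      (X3_bdd hAm hB hC _ _ _) (X3_bdd hAm hB hC _ _ _) (BddMeas.const' _)
      (Eventually.of_forall fun _ => by norm_num)
    have e : (fun ω => 1 / 2 * X3 A B C x y w ω + (1 - 1 / 2) * X3 A B C y x w ω) =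
        X3 A B C ((x + y) / 2) ((x + y) / 2) w := by
      funext ω
      unfold X3
      split_ifs <;> ring
    rw [e] at cv
    have := (cr ((x + y) / 2) ((x + y) / 2) w).2.1 (by
      filter_upwards [z1, z2, cv] with ω k1 k2 k3 hω
      rw [k1 hω, k2 hω] at k3
      linarith)
    have : b * (v ((x + y) / 2) + v ((x + y) / 2)) ≤ b * (v x + v y) := by linarith
    have := le_of_mul_le_mul_left this hb
    linarith
  have hom : ∃ c, 0 < c ∧ ∀ t, 0 ≤ t → f t = c * g t := by
    obtain ⟨b, hb, hb2, hbe⟩ := exists_weight (σ := v 1 + v 1) (τ := v (-1)) hp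
      (Or.inl ⟨by have := vm one_pos; rw [v0] at this; linarith,
        by rw [← v0]; exact vm (by norm_num)⟩)
    obtain ⟨B, C, hB, hC, hBA, hCA, hBC, eB, eC⟩ := sets b hb hb2
    have cr := crit b hb hb2 B C hB hC hBA hCA hBC eB eC
    have z1 := (cr 1 1 (-1)).1 hbe
    refine ⟨(P.real A - 2 * b) * (1 - α) / (b * 2 * α),
      div_pos (mul_pos (by linarith) hα1) (by positivity), fun t ht => ?_⟩
    have ph := hcoh.2 (X3 A B C 1 1 (-1)) (fun _ => t) (X3_bdd hAm hB hC _ _ _)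
      (BddMeas.const' _) (Eventually.of_forall fun _ => ht)
    have e : (fun ω => t * X3 A B C 1 1 (-1) ω) = X3 A B C t t (-t) := by
      funext ω
      unfold X3
      split_ifs <;> ring
    rw [e] at ph
    have z : ∀ᵐ ω ∂P, ω ∈ A → ρ (X3 A B C t t (-t)) ω = 0 := by
      filter_upwards [z1, ph] with ω k1 k2 hω
      rw [k2, k1 hω, mul_zero]
    have l1 := (cr t t (-t)).2.1 (z.mono fun ω h hω => (h hω).le)
    have l2 := (cr t t (-t)).2.2 (z.mono fun ω h hω => (h hω).ge)
    have l3 := le_antisymm l1 l2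
    rw [vpos t ht, vneg t ht] at l3
    field_simp
    linarith
  obtain ⟨c, hc, hfg⟩ := hom
  have df : ∀ t, 0 ≤ t → f (2 * t) = 2 * f t ∧ g (2 * t) = 2 * g t := by
    intro t ht
    have m1 := mid (2 * t) 0
    have m2 := mid (-(2 * t)) 0
    rw [v0, show (2 * t + 0) / 2 = t by ring, vpos t ht, vpos (2 * t) (by linarith)] at m1
    rw [v0, show (-(2 * t) + 0) / 2 = -t by ring, vneg t ht, vneg (2 * t) (by linarith)] at m2
    have n1 : f t ≤ f (2 * t) / 2 := le_of_mul_le_mul_left (by linarith) h0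
    have n2 : g (2 * t) / 2 ≤ g t := le_of_mul_le_mul_left (by linarith) hα1
    rw [hfg t ht, hfg (2 * t) (by linarith)] at n1
    have n3 : g t ≤ g (2 * t) / 2 := le_of_mul_le_mul_left (by linarith) hc
    have n4 : g (2 * t) = 2 * g t := by linarith
    refine ⟨?_, n4⟩
    rw [hfg t ht, hfg (2 * t) (by linarith), n4]; ring
  obtain ⟨c1, hl1⟩ := linear_of_double hf0 (hdd1 0 (mem_Ici.2 le_rfl)) (fun t ht => (df t ht).1)
  obtain ⟨c2, hl2⟩ := linear_of_double hg0 (hdd2 0 (mem_Ici.2 le_rfl)) (fun t ht => (df t ht).2)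
  obtain ⟨e1, q1⟩ := quad_of_linear hd1 hl1 hu1.2.2.1 hu1.2.2.2
  obtain ⟨e2, q2⟩ := quad_of_linear hd2 hl2 hu2.2.2.1 hu2.2.2.2
  refine ⟨q1, q2, ?_⟩
  have m := mid 1 (-1)
  rw [show ((1:ℝ) + -1) / 2 = 0 by norm_num, v0, vpos 1 zero_le_one, vneg 1 zero_le_one,
    hl1 1 zero_le_one, hl2 1 zero_le_one, e1, e2] at m
  linarith

end HelpersC

/-- Theorem 5.1 (ii):
(a) if `u1(x) = u2(x) = x²` and `α ≥ 1/2`, then the conditional generalized quantile (the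
conditional expectile) is a conditional coherent risk measure;
(b) conversely, if `𝒢` is generated by a finite partition of `Ω` with cells of positive
probability, `u1, u2 ∈ U⁺_icx` are twice differentiable and strictly convex with
`u1'(0) = u2'(0) = 0`, and the conditional generalized quantile is a conditional coherent
risk measure, then `u1(x) = u2(x) = x²` on `[0,∞)` and `α ≥ 1/2`. -/
theorem conditional_generalized_quantile_coherent_characterization
    [mΩ : MeasurableSpace Ω] (P : Measure Ω) [IsProbabilityMeasure P]
    (hP : Nonatomic P) (𝒢 : MeasurableSpace Ω) (hG : 𝒢 ≤ mΩ)
    {α : ℝ} (hα : α ∈ Set.Ioo (0:ℝ) 1) :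
    (∀ ρ : (Ω → ℝ) → (Ω → ℝ),
      (∀ X : Ω → ℝ, BddMeas mΩ X →
          IsEssInf P (ArgminSet P 𝒢 (fun x => x ^ 2) (fun x => x ^ 2) α X) (ρ X)) →
      1 / 2 ≤ α → IsCondCoherentRM P 𝒢 ρ)
    ∧ (∀ u1 u2 du1 du2 : ℝ → ℝ, Uicx u1 → Uicx u2 →
        StrictConvexOn ℝ (Set.Ici 0) u1 → StrictConvexOn ℝ (Set.Ici 0) u2 →
        (∀ x ∈ Set.Ici (0:ℝ), HasDerivWithinAt u1 (du1 x) (Set.Ici 0) x) →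
        (∀ x ∈ Set.Ici (0:ℝ), HasDerivWithinAt u2 (du2 x) (Set.Ici 0) x) →
        (∀ x ∈ Set.Ici (0:ℝ), DifferentiableWithinAt ℝ du1 (Set.Ici 0) x) →
        (∀ x ∈ Set.Ici (0:ℝ), DifferentiableWithinAt ℝ du2 (Set.Ici 0) x) →
        du1 0 = 0 → du2 0 = 0 →
        FinitePartitionGen P 𝒢 →
        ∀ ρ : (Ω → ℝ) → (Ω → ℝ),
          (∀ X : Ω → ℝ, BddMeas mΩ X → IsEssInf P (ArgminSet P 𝒢 u1 u2 α X) (ρ X)) →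
          IsCondCoherentRM P 𝒢 ρ →
          (∀ x ∈ Set.Ici (0:ℝ), u1 x = x ^ 2) ∧ (∀ x ∈ Set.Ici (0:ℝ), u2 x = x ^ 2) ∧
            1 / 2 ≤ α) := by
  exact ⟨fun ρ hρ h => partA_s14 hG hα ρ hρ h,
    fun u1 u2 du1 du2 a1 a2 a3 a4 a5 a6 a7 a8 a9 a10 a11 ρ hρ hc =>
      partB_s14 hP hG hα u1 u2 du1 du2 a1 a2 a3 a4 a5 a6 a7 a8 a9 a10 a11 ρ hρ hc⟩
end
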